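/- There is a universal constant c > 0 such that the following holds. Let I be a GCMP instance with k robots. For every robot R_i ∈ F whose starting vertex is within distance λ_i of a nice vertex, there exists a set B(R_i, λ_i) ⊆ V(G) of cardinality at most k^{c·(λ_i·k + k⁴)} such that: for any schedule opt(I) for I of minimum total traveled length, there exists a schedule opt'(I) of the same (minimum) total traveled length in which R_i occupies only vertices of B(R_i, λ_i) and every other robot moves exactly as in opt(I). -/

import Mathlib

open SimpleGraph

/-- A GCMP instance on a graph `G` with `k` robots: `isM i` holds iff robot `i` belongs
to the set `M` of robots with destinations (otherwise it is a free robot of `F`);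
`start` gives the starting vertices (pairwise distinct), and `dest` gives the
destination vertices of the robots in `M` (pairwise distinct on `M`). -/
structure Inst (V : Type) (G : SimpleGraph V) (k : ℕ) where
  isM : Fin k → Prop
  start : Fin k → V
  dest : Fin k → V
  start_inj : Function.Injective start
  dest_injOn : Set.InjOn dest {i | isM i}

/-- A schedule for a GCMP instance: positions `pos j i` of robot `i` at time `j ∈ [0,T]`,
each robot follows a route (stay or move along an edge), starting at its starting vertex,
robots of `M` ending at their destinations, and the routes are pairwise non-conflicting
(no two robots on the same vertex at the same time, and no edge swap). -/
structure Sched {V : Type} {G : SimpleGraph V} {k : ℕ} (I : Inst V G k) where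
  T : ℕ
  pos : ℕ → Fin k → V
  init : ∀ i, pos 0 i = I.start i
  final : ∀ i, I.isM i → pos T i = I.dest i
  step : ∀ j, j < T → ∀ i, pos (j + 1) i = pos j i ∨ G.Adj (pos j i) (pos (j + 1) i)
  noVertexConflict : ∀ j, j ≤ T → Function.Injective fun i => pos j i
  noSwap : ∀ j, j < T → ∀ i i', i ≠ i' →
      ¬(pos (j + 1) i = pos j i' ∧ pos (j + 1) i' = pos j i)

/-- The (traveled) length of the route of robot `i` in schedule `S`:
the number of time steps at which robot `i` moves. -/
noncomputable def routeLength {V : Type} {G : SimpleGraph V} {k : ℕ} {I : Inst V G k}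
    (S : Sched I) (i : Fin k) : ℕ :=
  {j : ℕ | j < S.T ∧ S.pos j i ≠ S.pos (j + 1) i}.ncard

/-- The total traveled length (energy) of a schedule. -/
noncomputable def totalLength {V : Type} {G : SimpleGraph V} {k : ℕ} {I : Inst V G k}
    (S : Sched I) : ℕ :=
  ∑ i : Fin k, routeLength S i

/-- A schedule is optimal if it has minimum total traveled length. -/
def Optimal {V : Type} {G : SimpleGraph V} {k : ℕ} {I : Inst V G k}
    (S : Sched I) : Prop :=
  ∀ S' : Sched I, totalLength S ≤ totalLength S'

/-- A vertex `w` of `G` is *nice* with respect to `k` if there are three connected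
subgraphs `C1, C2, C3` of `G` whose vertex sets pairwise intersect exactly in `{w}`,
with `|V(C1)| ≥ k+1`, `|V(C2)| ≥ k+1` and `|V(C3)| ≥ 2`. -/
def IsNice {V : Type} (G : SimpleGraph V) (k : ℕ) (w : V) : Prop :=
  ∃ C1 C2 C3 : G.Subgraph,
    C1.Connected ∧ C2.Connected ∧ C3.Connected ∧
    C1.verts ∩ C2.verts = {w} ∧ C1.verts ∩ C3.verts = {w} ∧ C2.verts ∩ C3.verts = {w} ∧
    k + 1 ≤ C1.verts.ncard ∧ k + 1 ≤ C2.verts.ncard ∧ 2 ≤ C3.verts.ncard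

/-- `H` is the haven of the nice vertex `w` built from the witnessing connected subgraphs
`C1, C2, C3` and a neighbor `x` of `w` lying in `C3`: it consists of those vertices of
`{x} ∪ V(C1) ∪ V(C2)` whose distance from `w` within (the subgraph induced by)
`{x} ∪ V(C1) ∪ V(C2)` is at most `k`. -/
def IsHavenWith {V : Type} (G : SimpleGraph V) (k : ℕ) (w : V)
    (C1 C2 C3 : G.Subgraph) (x : V) (H : Set V) : Prop :=
  C1.Connected ∧ C2.Connected ∧ C3.Connected ∧
  C1.verts ∩ C2.verts = {w} ∧ C1.verts ∩ C3.verts = {w} ∧ C2.verts ∩ C3.verts = {w} ∧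
  k + 1 ≤ C1.verts.ncard ∧ k + 1 ≤ C2.verts.ncard ∧ 2 ≤ C3.verts.ncard ∧
  x ∈ C3.verts ∧ G.Adj w x ∧
  ∃ hw : w ∈ ({x} ∪ C1.verts ∪ C2.verts : Set V),
    H = {u : V | ∃ hu : u ∈ ({x} ∪ C1.verts ∪ C2.verts : Set V),
          (G.induce ({x} ∪ C1.verts ∪ C2.verts : Set V)).dist ⟨w, hw⟩ ⟨u, hu⟩ ≤ k}

/-- `H` is a haven for `w` (for some choice of witnesses). -/
def IsHaven {V : Type} (G : SimpleGraph V) (k : ℕ) (w : V) (H : Set V) : Prop :=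
  ∃ (C1 C2 C3 : G.Subgraph) (x : V), IsHavenWith G k w C1 C2 C3 x H


set_option linter.unusedSectionVars false
section Aux
variable {V : Type} [DecidableEq V] {G : SimpleGraph V} {k : ℕ}

def Stp (G : SimpleGraph V) (c c' : Fin k → V) : Prop :=
  Function.Injective c ∧ Function.Injective c' ∧
  (∀ r, c' r = c r ∨ G.Adj (c r) (c' r)) ∧
  ∀ r r', r ≠ r' → ¬(c' r = c r' ∧ c' r' = c r)

def cst (c c' : Fin k → V) : ℕ := (Finset.univ.filter (fun r => c r ≠ c' r)).card

inductive Mv (G : SimpleGraph V) : ℕ → (Fin k → V) → (Fin k → V) → Prop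
  | refl (n : ℕ) (c : Fin k → V) : Mv G n c c
  | tail {n m : ℕ} {c c' c'' : Fin k → V} : Mv G n c c' → Stp G c' c'' →
      n + cst c' c'' ≤ m → Mv G m c c''

theorem Mv.mono {n m : ℕ} {c c' : Fin k → V} (h : Mv G n c c') (hm : n ≤ m) : Mv G m c c' := by
  cases h with
  | refl => exact Mv.refl _ _
  | tail h1 h2 h3 => exact Mv.tail h1 h2 (h3.trans hm)

theorem Mv.trans {n m : ℕ} {c c' c'' : Fin k → V} (h : Mv G n c c') (h' : Mv G m c' c'') :
    Mv G (n + m) c c'' := by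
  induction h' with
  | refl m c' => exact h.mono (by omega)
  | tail h1 h2 h3 ih => exact Mv.tail (ih h) h2 (by omega)

theorem Mv.trans' {n m l : ℕ} {c c' c'' : Fin k → V} (h : Mv G n c c') (h' : Mv G m c' c'')
    (hl : n + m ≤ l) : Mv G l c c'' := (h.trans h').mono hl

theorem Stp.symm {c c' : Fin k → V} (h : Stp G c c') : Stp G c' c := by
  obtain ⟨h1, h2, h3, h4⟩ := h
  refine ⟨h2, h1, fun r => ?_, fun r r' hr hh => h4 r r' hr ⟨hh.2.symm, hh.1.symm⟩⟩
  rcases h3 r with h | h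
  · exact Or.inl h.symm
  · exact Or.inr h.symm

theorem cst_comm (c c' : Fin k → V) : cst c c' = cst c' c := by
  unfold cst; congr 1; ext r; simp [eq_comm]

theorem Mv.symm {n : ℕ} {c c' : Fin k → V} (h : Mv G n c c') : Mv G n c' c := by
  induction h with
  | refl n c => exact Mv.refl _ _
  | tail h1 h2 h3 ih =>
    refine Mv.trans' (Mv.tail (Mv.refl 0 _) h2.symm le_rfl) ih ?_
    rw [cst_comm]; omega

theorem Mv.inj {n : ℕ} {c c' : Fin k → V} (h : Mv G n c c') (hc : Function.Injective c) :
    Function.Injective c' := by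
  cases h with
  | refl => exact hc
  | tail h1 h2 h3 => exact h2.2.1

theorem Mv.one {c : Fin k → V} (hc : Function.Injective c) {r : Fin k} {v : V}
    (ha : G.Adj (c r) v) (hv : ∀ s, c s ≠ v) : Mv G 1 c (Function.update c r v) := by
  refine Mv.tail (Mv.refl 0 c) ⟨hc, ?_, ?_, ?_⟩ ?_
  · intro s s' h
    by_cases h1 : s = r <;> by_cases h2 : s' = r
    · rw [h1, h2]
    · subst h1; simp [Function.update_of_ne h2] at h; exact absurd h.symm (hv s')
    · subst h2; simp [Function.update_of_ne h1] at h; exact absurd h (hv s)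
    · simp [Function.update_of_ne h1, Function.update_of_ne h2] at h; exact hc h
  · intro s
    by_cases h1 : s = r
    · subst h1; right; simpa using ha
    · left; simp [Function.update_of_ne h1]
  · rintro s s' hs ⟨h1, h2⟩
    by_cases h3 : s = r
    · subst h3; simp at h1; exact hv s' h1.symm
    · rw [Function.update_of_ne h3] at h1; exact hs (hc h1)
  · unfold cst
    rw [zero_add, Finset.card_le_one]
    intro a ha b hb
    simp only [Finset.mem_filter, Finset.mem_univ, true_and] at ha hb
    have : ∀ a, c a ≠ Function.update c r v a → a = r := by
      intro a h; by_contra h'; exact h (by rw [Function.update_of_ne h'])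
    rw [this a ha, this b hb]

def Supp (X : Finset V) (c c' : Fin k → V) : Prop :=
  ∀ r, (c r ∈ X ∧ c' r ∈ X) ∨ c' r = c r

theorem Supp.mono {X Y : Finset V} {c c' : Fin k → V} (h : Supp X c c') (hXY : X ⊆ Y) :
    Supp Y c c' := fun r => (h r).imp (fun h => ⟨hXY h.1, hXY h.2⟩) id

theorem Supp.refl (X : Finset V) (c : Fin k → V) : Supp X c c := fun _ => Or.inr rfl

theorem Supp.trans {X : Finset V} {c c' c'' : Fin k → V} (h : Supp X c c') (h' : Supp X c' c'') :
    Supp X c c'' := by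
  intro r; have := h r; have := h' r; grind

theorem Supp.upd {X : Finset V} {c : Fin k → V} {r : Fin k} {v : V} (h : c r ∈ X) (hv : v ∈ X) :
    Supp X c (Function.update c r v) := by
  intro s
  by_cases hs : s = r
  · subst hs; left; simp [h, hv]
  · right; rw [Function.update_of_ne hs]

theorem Supp.mem_iff {X Y : Finset V} {c c' : Fin k → V} (h : Supp X c c') (hXY : X ⊆ Y) (r : Fin k) :
    c' r ∈ Y ↔ c r ∈ Y := by
  rcases h r with h | h
  · exact ⟨fun _ => hXY h.1, fun _ => hXY h.2⟩
  · rw [h]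

theorem Supp.mem_iff' {X Y : Finset V} {c c' : Fin k → V} (h : Supp X c c') (hXY : Disjoint X Y)
    (r : Fin k) : c' r ∈ Y ↔ c r ∈ Y := by
  rw [Finset.disjoint_left] at hXY
  rcases h r with h | h
  · exact ⟨fun h' => absurd h' (hXY h.2), fun h' => absurd h' (hXY h.1)⟩
  · rw [h]

def cnt (c : Fin k → V) (X : Finset V) : ℕ := (Finset.univ.filter (fun r => c r ∈ X)).card

theorem cnt_congr {c c' : Fin k → V} {X : Finset V} (h : ∀ r, c' r ∈ X ↔ c r ∈ X) :
    cnt c' X = cnt c X := by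
  unfold cnt; congr 1; ext r; simp [h r]

theorem cnt_mono {c : Fin k → V} {X Y : Finset V} (h : X ⊆ Y) : cnt c X ≤ cnt c Y :=
  Finset.card_le_card (fun r hr => by simp at hr ⊢; exact h hr)

theorem cnt_lt {c c' : Fin k → V} {X Y : Finset V} (h : ∀ r, c r ∈ X → c' r ∈ Y) (r : Fin k)
    (h1 : c r ∉ X) (h2 : c' r ∈ Y) : cnt c X < cnt c' Y := by
  refine Finset.card_lt_card ⟨fun r hr => by simp at hr ⊢; exact h r hr, fun hh => ?_⟩
  have := @hh r (by simp [h2])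
  simp at this; exact h1 this

theorem cnt_le_k (c : Fin k → V) (X : Finset V) : cnt c X ≤ k := by
  unfold cnt; exact (Finset.card_filter_le _ _).trans (by simp)

theorem exists_hole {c : Fin k → V} {X : Finset V} (h : cnt c X < X.card) :
    ∃ v ∈ X, ∀ s, c s ≠ v := by
  by_contra hh
  push Not at hh
  have : X ⊆ (Finset.univ.filter (fun r => c r ∈ X)).image c := by
    intro v hv
    obtain ⟨s, hs⟩ := hh v hv
    simp; exact ⟨s, by rw [hs]; exact hv, hs⟩
  have := (Finset.card_le_card this).trans Finset.card_image_le
  unfold cnt at h; omega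

def RT (G : SimpleGraph V) (w : V) (A : Finset V) (h : ℕ) : Prop :=
  w ∉ A ∧ ∃ (par : V → V) (d : V → ℕ), ∀ a ∈ A, G.Adj a (par a) ∧ par a ∈ insert w A ∧
    d (par a) < d a ∧ d a ≤ h

theorem RT.push {w : V} {A : Finset V} {h : ℕ} (hA : RT G w A h) {c : Fin k → V}
    (hc : Function.Injective c) (hole : ∃ v ∈ insert w A, ∀ s, c s ≠ v) :
    ∃ c', Mv G h c c' ∧ Supp (insert w A) c c' ∧ ∀ s, c' s ≠ w := by
  obtain ⟨hw, par, d, hd⟩ := hA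
  obtain ⟨v, hv, hh⟩ := hole
  by_cases hvw : v = w
  · subst hvw; exact ⟨c, Mv.refl _ _, Supp.refl _ _, hh⟩
  have key : ∀ n, ∀ v ∈ A, d v ≤ n → ∀ c : Fin k → V, Function.Injective c → (∀ s, c s ≠ v) →
      ∃ c', Mv G n c c' ∧ Supp (insert w A) c c' ∧ ∀ s, c' s ≠ w := by
    intro n
    induction n with
    | zero => intro v hv hd'; have := hd v hv; omega
    | succ n ih =>
      intro v hv hdv c hc hh
      obtain ⟨h1, h2, h3, h4⟩ := hd v hv
      have : ∃ c1, Mv G 1 c c1 ∧ Supp (insert w A) c c1 ∧ ∀ s, c1 s ≠ par v := by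
        by_cases he : ∃ s, c s = par v
        · obtain ⟨s, hs⟩ := he
          refine ⟨Function.update c s v, Mv.one hc (by rw [hs]; exact h1.symm) hh,
            Supp.upd (by rw [hs]; exact h2) (by simp [hv]), fun t ht => ?_⟩
          by_cases hts : t = s
          · subst hts; simp at ht; exact h1.ne ht
          · rw [Function.update_of_ne hts] at ht; exact hts (hc (ht.trans hs.symm))
        · push Not at he
          exact ⟨c, Mv.refl _ _, Supp.refl _ _, he⟩
      obtain ⟨c1, m1, s1, e1⟩ := this
      rcases Finset.mem_insert.1 h2 with h5 | h5
      · exact ⟨c1, m1.mono (by omega), s1, by rw [← h5]; exact e1⟩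
      · obtain ⟨c2, m2, s2, e2⟩ := ih (par v) h5 (by omega) c1 (m1.inj hc) e1
        exact ⟨c2, m1.trans' m2 (by omega), s1.trans s2, e2⟩
  have hvA : v ∈ A := (Finset.mem_insert.1 hv).resolve_left hvw
  exact key h v hvA (hd v hvA).2.2.2 c hc hh

theorem RT.pull {w : V} {A : Finset V} {h : ℕ} (hA : RT G w A h) {c : Fin k → V}
    (hc : Function.Injective c) (hr : ∃ r, c r ∈ A) :
    ∃ c', Mv G h c c' ∧ Supp (insert w A) c c' ∧ ∃ s, c' s = w := by
  obtain ⟨hw, par, d, hd⟩ := hA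
  obtain ⟨r, hr⟩ := hr
  have key : ∀ n, ∀ c : Fin k → V, Function.Injective c → ∀ r, c r ∈ A → d (c r) ≤ n →
      ∃ c', Mv G n c c' ∧ Supp (insert w A) c c' ∧ ∃ s, c' s = w := by
    intro n
    induction n with
    | zero => intro c _ r hr hd'; have := hd _ hr; omega
    | succ n ih =>
      intro c hc r hr hdr
      obtain ⟨h1, h2, h3, h4⟩ := hd _ hr
      have : ∃ c1, Mv G 1 c c1 ∧ Supp (insert w A) c c1 ∧ ∃ s, c1 s = par (c r) := by
        by_cases he : ∃ s, c s = par (c r)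
        · exact ⟨c, Mv.refl _ _, Supp.refl _ _, he⟩
        · push Not at he
          exact ⟨Function.update c r (par (c r)), Mv.one hc h1 he,
            Supp.upd (by simp [hr]) h2, r, by simp⟩
      obtain ⟨c1, m1, s1, s, e1⟩ := this
      rcases Finset.mem_insert.1 h2 with h5 | h5
      · exact ⟨c1, m1.mono (by omega), s1, s, e1.trans h5⟩
      · obtain ⟨c2, m2, s2, e2⟩ := ih c1 (m1.inj hc) s (by rw [e1]; exact h5) (by rw [e1]; omega)
        exact ⟨c2, m1.trans' m2 (by omega), s1.trans s2, e2⟩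
  exact key h c hc r hr (hd _ hr).2.2.2

theorem RT.walk {w : V} {A : Finset V} {h : ℕ} (hA : RT G w A h) {c : Fin k → V}
    (hc : Function.Injective c) {r : Fin k} (hr : c r ∈ A) (he : ∀ s, s ≠ r → c s ∉ insert w A) :
    Mv G h c (Function.update c r w) := by
  obtain ⟨hw, par, d, hd⟩ := hA
  have key : ∀ n, ∀ c : Fin k → V, Function.Injective c → c r ∈ A → d (c r) ≤ n →
      (∀ s, s ≠ r → c s ∉ insert w A) → Mv G n c (Function.update c r w) := by
    intro n
    induction n with
    | zero => intro c _ hr hd'; have := hd _ hr; omega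
    | succ n ih =>
      intro c hc hr hdr he
      obtain ⟨h1, h2, h3, h4⟩ := hd _ hr
      have m1 : Mv G 1 c (Function.update c r (par (c r))) := by
        refine Mv.one hc h1 fun s hs => ?_
        by_cases hsr : s = r
        · subst hsr; exact h1.ne hs
        · exact he s hsr (by rw [hs]; exact h2)
      rcases Finset.mem_insert.1 h2 with h5 | h5
      · rw [h5] at m1; exact m1.mono (by omega)
      · have := ih _ (m1.inj hc) (by simpa using h5) (by simp; omega)
          (fun s hs => by rw [Function.update_of_ne hs]; exact he s hs)
        rw [Function.update_idem] at this
        exact m1.trans' this (by omega)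
  exact key h c hc hr (hd _ hr).2.2.2 he

theorem RT.drain {w : V} {A B : Finset V} {h : ℕ} (hA : RT G w A h) (hB : RT G w B h)
    (hd : Disjoint A B) (n : ℕ) : ∀ c : Fin k → V, Function.Injective c → (∀ s, c s ≠ w) →
    cnt c A ≤ n → cnt c (A ∪ B) ≤ B.card →
    ∃ c', Mv G (n * (2 * h)) c c' ∧ Supp (insert w (A ∪ B)) c c' ∧ (∀ s, c' s ≠ w) ∧
      ∀ s, c' s ∉ A := by
  induction n with
  | zero =>
    intro c hc hw h1 h2
    refine ⟨c, Mv.refl _ _, Supp.refl _ _, hw, fun s hs => ?_⟩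
    have : 0 < cnt c A := Finset.card_pos.2 ⟨s, by simp [hs]⟩
    omega
  | succ n ih =>
    intro c hc hw h1 h2
    by_cases hex : ∃ r, c r ∈ A
    swap
    · push Not at hex
      exact ⟨c, Mv.refl _ _, Supp.refl _ _, hw, hex⟩
    obtain ⟨c1, m1, s1, r, e1⟩ := hA.pull hc hex
    have hwA := hA.1
    have hwB := hB.1
    have hd' := Finset.disjoint_left.1 hd
    have hcr : c r ∈ A := by
      have := s1 r
      have := hw r
      grind
    have hBB : ∀ s, c1 s ∈ B ↔ c s ∈ B := s1.mem_iff' (by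
      rw [Finset.disjoint_left]; intro a; have := @hd' a; grind)
    have hlt : cnt c1 B < B.card := by
      rw [cnt_congr hBB]
      refine lt_of_lt_of_le (cnt_lt (c' := c) (Y := A ∪ B) (fun s hs => by simp [hs]) r (hd' hcr) (by simp [hcr])) h2
    obtain ⟨v, hv, hh⟩ := exists_hole hlt
    obtain ⟨c2, m2, s2, e2⟩ := hB.push (m1.inj hc) ⟨v, by simp [hv], hh⟩
    have hAA : ∀ s, c2 s ∈ A ↔ c1 s ∈ A := s2.mem_iff' (by
      rw [Finset.disjoint_left]; intro a; have := @hd' a; grind)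
    have s12 : Supp (insert w (A ∪ B)) c c2 :=
      (s1.mono (by grind)).trans (s2.mono (by grind))
    have hdec : cnt c2 A < cnt c A := by
      refine cnt_lt (fun s hs => ?_) r ?_ hcr
      · have := (hAA s).1 hs
        have := s1 s
        have := hw s
        grind
      · rw [hAA, e1]; exact hwA
    have hun : cnt c2 (A ∪ B) = cnt c (A ∪ B) := by
      refine cnt_congr fun s => ?_
      have := s12.mem_iff (Finset.Subset.refl _) s
      have := hw s
      have := e2 s
      grind
    obtain ⟨c3, m3, s3, e3, e4⟩ := ih c2 (m2.inj (m1.inj hc)) e2 (by omega) (by omega)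
    exact ⟨c3, (m1.trans m2).trans' m3 (by ring_nf; omega), s12.trans s3, e3, e4⟩

structure Hv (G : SimpleGraph V) (h : ℕ) (w x : V) (A B : Finset V) : Prop where
  rA : RT G w A h
  rB : RT G w B h
  disj : Disjoint A B
  xA : x ∉ A
  xB : x ∉ B
  xw : x ≠ w
  adj : G.Adj w x

def HH (w x : V) (A B : Finset V) : Finset V := insert w (insert x (A ∪ B))

theorem Hv.extract {w x : V} {A B : Finset V} {h : ℕ} (hv : Hv G h w x A B) (hh : 1 ≤ h)
    (r1 : Fin k) (n : ℕ) : ∀ c : Fin k → V, Function.Injective c → (∀ s, c s ≠ w) →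
    (∀ s, c s ≠ x) → c r1 ∈ B →
    cnt c B ≤ n → cnt c (A ∪ B) ≤ A.card →
    ∃ c', Mv G (n * (2 * h)) c c' ∧ Supp (HH w x A B) c c' ∧ (∀ s, c' s ≠ w) ∧ c' r1 = x := by
  have hwA := hv.rA.1
  have hwB := hv.rB.1
  have hxA := hv.xA
  have hxB := hv.xB
  have hxw := hv.xw
  have hd' := Finset.disjoint_left.1 hv.disj
  induction n with
  | zero =>
    intro c hc hw hx hr h1 h2
    have : 0 < cnt c B := Finset.card_pos.2 ⟨r1, by simp [hr]⟩
    omega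
  | succ n ih =>
    intro c hc hw hx hr h1 h2
    obtain ⟨c1, m1, s1, r, e1⟩ := hv.rB.pull hc ⟨r1, hr⟩
    have hcr : c r ∈ B := by
      have := s1 r
      have := hw r
      grind
    have hx1 : ∀ s, c1 s ≠ x := by
      intro s
      have := s1 s
      have := hx s
      grind
    have i1 := m1.inj hc
    by_cases hrr : r = r1
    · subst hrr
      refine ⟨Function.update c1 r x, m1.trans' (Mv.one i1 (by rw [e1]; exact hv.adj) hx1)
        (by ring_nf; nlinarith),
        (s1.mono (by unfold HH; grind)).trans (Supp.upd (by rw [e1]; simp [HH]) (by simp [HH])), fun s hs => ?_, by simp⟩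
      by_cases hsr : s = r
      · subst hsr; simp at hs; exact hxw hs
      · rw [Function.update_of_ne hsr] at hs; exact hsr (i1 (hs.trans e1.symm))
    have hAA : ∀ s, c1 s ∈ A ↔ c s ∈ A := s1.mem_iff' (by
      rw [Finset.disjoint_left]; intro a; have := @hd' a; grind)
    have hlt : cnt c1 A < A.card := by
      rw [cnt_congr hAA]
      refine lt_of_lt_of_le (cnt_lt (c' := c) (Y := A ∪ B) (fun s hs => by simp [hs]) r (fun h => hd' h hcr) (by simp [hcr])) h2
    obtain ⟨v, hv', hh'⟩ := exists_hole hlt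
    obtain ⟨c2, m2, s2, e2⟩ := hv.rA.push i1 ⟨v, by simp [hv'], hh'⟩
    have hBB : ∀ s, c2 s ∈ B ↔ c1 s ∈ B := s2.mem_iff' (by
      rw [Finset.disjoint_left]; intro a; have := @hd' a; grind)
    have s12 : Supp (insert w (A ∪ B)) c c2 :=
      (s1.mono (by grind)).trans (s2.mono (by grind))
    have hdec : cnt c2 B < cnt c B := by
      refine cnt_lt (fun s hs => ?_) r ?_ hcr
      · have := (hBB s).1 hs
        have := s1 s
        have := hw s
        grind
      · rw [hBB, e1]; exact hwB
    have hun : cnt c2 (A ∪ B) = cnt c (A ∪ B) := by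
      refine cnt_congr fun s => ?_
      have := s12.mem_iff (Finset.Subset.refl _) s
      have := hw s
      have := e2 s
      grind
    have hr1 : c2 r1 ∈ B := by
      rw [hBB]
      have := s1 r1
      have : c1 r1 ≠ w := fun h => hrr (i1 (e1.trans h.symm))
      grind
    have hx2 : ∀ s, c2 s ≠ x := by
      intro s
      have := s2 s
      have := hx1 s
      grind
    obtain ⟨c3, m3, s3, e3, e4⟩ := ih c2 (m2.inj i1) e2 hx2 hr1 (by omega) (by omega)
    exact ⟨c3, (m1.trans m2).trans' m3 (by ring_nf; omega),
      (s12.mono (by unfold HH; grind)).trans s3, e3, e4⟩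

theorem Hv.gather {w x : V} {A B : Finset V} (hv : Hv G k w x A B)
    {c : Fin k → V} (hc : Function.Injective c) (hB : cnt c (HH w x A B) ≤ B.card) :
    ∃ c', Mv G (k + k * (2 * k) + 1 + k) c c' ∧ Supp (HH w x A B) c c' ∧
      (∀ s, c' s ≠ w) ∧ (∀ s, c' s ≠ x) ∧ ∀ s, c' s ∉ A := by
  have hwA := hv.rA.1
  have hwB := hv.rB.1
  have hxA := hv.xA
  have hxB := hv.xB
  have hxw := hv.xw
  have hd' := Finset.disjoint_left.1 hv.disj
  have clear : ∀ c : Fin k → V, Function.Injective c → cnt c (HH w x A B) ≤ B.card →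
      ∃ c', Mv G k c c' ∧ Supp (insert w B) c c' ∧ ∀ s, c' s ≠ w := by
    intro c hc hB
    by_cases he : ∃ r, c r = w
    · obtain ⟨r, hr⟩ := he
      have : cnt c B < B.card := by
        refine lt_of_lt_of_le (cnt_lt (c' := c) (Y := HH w x A B) (fun s hs => by simp [HH, hs]) r (by rw [hr]; exact hwB) (by rw [hr]; simp [HH])) hB
      obtain ⟨v, hv', hh'⟩ := exists_hole this
      exact hv.rB.push hc ⟨v, by simp [hv'], hh'⟩
    · push Not at he
      exact ⟨c, Mv.refl _ _, Supp.refl _ _, he⟩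
  obtain ⟨c1, m1, s1, e1⟩ := clear c hc hB
  have s1' : Supp (HH w x A B) c c1 := s1.mono (by unfold HH; grind)
  have hB1 : cnt c1 (HH w x A B) ≤ B.card := by
    rw [cnt_congr (s1'.mem_iff (Finset.Subset.refl _))]; exact hB
  obtain ⟨c2, m2, s2, e2, f2⟩ := hv.rA.drain hv.rB hv.disj k c1 (m1.inj hc) e1 (cnt_le_k _ _)
    ((cnt_mono (by unfold HH; grind)).trans hB1)
  have s2' : Supp (HH w x A B) c1 c2 := s2.mono (by unfold HH; grind)
  have i2 := m2.inj (m1.inj hc)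
  by_cases he : ∃ r, c2 r = x
  · obtain ⟨r, hr⟩ := he
    have m3 : Mv G 1 c2 (Function.update c2 r w) :=
      Mv.one i2 (by rw [hr]; exact hv.adj.symm) e2
    have s3 : Supp (HH w x A B) c2 (Function.update c2 r w) :=
      Supp.upd (by rw [hr]; simp [HH]) (by simp [HH])
    have hB3 : cnt (Function.update c2 r w) (HH w x A B) ≤ B.card := by
      rw [cnt_congr (((s1'.trans s2').trans s3).mem_iff (Finset.Subset.refl _))]; exact hB
    obtain ⟨c4, m4, s4, e4⟩ := clear _ (m3.inj i2) hB3
    refine ⟨c4, (((m1.trans m2).trans m3).trans m4), ((s1'.trans s2').trans s3).trans (s4.mono (by unfold HH; grind)), e4, fun s hs => ?_, fun s hs => ?_⟩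
    · have h4 := s4 s
      by_cases hsr : s = r
      · subst hsr; simp at h4; grind
      · rw [Function.update_of_ne hsr] at h4
        have : c2 s ≠ x := fun h => hsr (i2 (h.trans hr.symm))
        grind
    · have h4 := s4 s
      have := @hd' (c4 s)
      by_cases hsr : s = r
      · subst hsr; simp at h4; grind
      · rw [Function.update_of_ne hsr] at h4
        have := f2 s
        grind
  · push Not at he
    exact ⟨c2, m1.trans' m2 (by omega), s1'.trans s2', e2, he, f2⟩

theorem Hv.place {w x : V} {A B : Finset V} (hv : Hv G k w x A B)
    {c : Fin k → V} (hc : Function.Injective c) (hA : cnt c (HH w x A B) ≤ A.card)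
    (hB : cnt c (HH w x A B) ≤ B.card) (r1 : Fin k) (hr1 : c r1 ∈ HH w x A B) (a : V) (ha : a ∈ A) :
    ∃ c', Mv G (11 * k ^ 2) c c' ∧ Supp (HH w x A B) c c' ∧ c' r1 = a := by
  have hwA := hv.rA.1
  have hwB := hv.rB.1
  have hxA := hv.xA
  have hxB := hv.xB
  have hxw := hv.xw
  have hd' := Finset.disjoint_left.1 hv.disj
  have hk : 1 ≤ k := by have := r1.2; omega
  obtain ⟨c1, m1, s1, e1, f1, g1⟩ := hv.gather hc hB
  have i1 := m1.inj hc
  have hr1' : c1 r1 ∈ B := by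
    have := (s1.mem_iff (Finset.Subset.refl _) r1).2 hr1
    have := e1 r1; have := f1 r1; have := g1 r1
    unfold HH at *; grind
  have hA1 : cnt c1 (HH w x A B) = cnt c (HH w x A B) :=
    cnt_congr (s1.mem_iff (Finset.Subset.refl _))
  obtain ⟨c2, m2, s2, e2, f2⟩ := hv.extract hk r1 k c1 i1 e1 f1 hr1' (cnt_le_k _ _)
    ((cnt_mono (by unfold HH; grind)).trans (hA1.trans_le hA))
  have hA2 : cnt c2 (HH w x A B) = cnt c1 (HH w x A B) :=
    cnt_congr (s2.mem_iff (Finset.Subset.refl _))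
  have i2 := m2.inj i1
  obtain ⟨c3, m3, s3, e3, g3⟩ := hv.rA.drain hv.rB hv.disj k c2 i2 e2 (cnt_le_k _ _)
    ((cnt_mono (by unfold HH; grind)).trans (hA2.trans_le (hA1.trans_le hB)))
  have i3 := m3.inj i2
  have f3 : c3 r1 = x := by
    have := s3 r1
    grind
  have m4 : Mv G 1 c3 (Function.update c3 r1 w) := Mv.one i3 (by rw [f3]; exact hv.adj.symm) e3
  have i4 := m4.inj i3
  have i5 : Function.Injective (Function.update c3 r1 a) := by
    intro s s' h
    by_cases h1 : s = r1 <;> by_cases h2 : s' = r1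
    · rw [h1, h2]
    · subst h1; simp [Function.update_of_ne h2] at h; exact absurd (h ▸ ha) (g3 s')
    · subst h2; simp [Function.update_of_ne h1] at h; exact absurd (h ▸ ha) (g3 s)
    · simp [Function.update_of_ne h1, Function.update_of_ne h2] at h; exact i3 h
  have m5 := hv.rA.walk (r := r1) i5 (by simpa using ha) (fun s hs => by
    rw [Function.update_of_ne hs]; have := e3 s; have := g3 s; grind)
  rw [Function.update_idem] at m5
  refine ⟨Function.update c3 r1 a, ((((m1.trans m2).trans m3).trans m4).trans' m5.symm ?_), ?_, by simp⟩
  · nlinarith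
  · exact ((s1.trans s2).trans (s3.mono (by unfold HH; grind))).trans
      (Supp.upd (by rw [f3]; simp [HH]) (by simp [HH, ha]))

theorem Hv.canon {w x : V} {B : Finset V} (m : ℕ) : ∀ A : Finset V, Hv G k w x A B →
    m ≤ A.card → m ≤ B.card → ∀ Q : Finset (Fin k), Q.card = m →
    ∃ f : Fin k → V, ∀ p : Fin k → V, Function.Injective p → (∀ r, r ∈ Q ↔ p r ∈ HH w x A B) →
      Mv G (m * (11 * k ^ 2)) p (fun r => if r ∈ Q then f r else p r) := by
  induction m with
  | zero =>
    intro A hv _ _ Q hQ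
    rw [Finset.card_eq_zero] at hQ
    subst hQ
    exact ⟨fun _ => w, fun p _ _ => by simpa using Mv.refl _ _⟩
  | succ m ih =>
    intro A hv hA hB Q hQ
    obtain ⟨r1, Q', hr1, rfl, hQ'⟩ := Finset.card_eq_succ.1 hQ
    obtain ⟨hwA, par, d, hd⟩ := hv.rA
    have hne : A.Nonempty := Finset.card_pos.1 (by omega)
    obtain ⟨a, ha, hmax⟩ := Finset.exists_max_image A d hne
    have hv' : Hv G k w x (A.erase a) B := by
      refine ⟨⟨by simp [hwA], par, d, fun b hb => ?_⟩, hv.rB, ?_, ?_, hv.xB, hv.xw, hv.adj⟩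
      · have hb' := Finset.mem_of_mem_erase hb
        obtain ⟨h1, h2, h3, h4⟩ := hd b hb'
        refine ⟨h1, ?_, h3, h4⟩
        have := hmax b hb'
        have : par b ≠ a := by rintro h; rw [h] at h3; omega
        grind
      · exact hv.disj.mono_left (Finset.erase_subset _ _)
      · simp [hv.xA]
    obtain ⟨f, hf⟩ := ih (A.erase a) hv' (by rw [Finset.card_erase_of_mem ha]; omega) (by omega) Q' hQ'
    refine ⟨Function.update f r1 a, fun p hp hpQ => ?_⟩
    have hcnt : cnt p (HH w x A B) = m + 1 := by
      rw [← hQ]; unfold cnt; congr 1; ext r; simp [← hpQ]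
    obtain ⟨p1, m1, s1, e1⟩ := hv.place hp (by omega) (by omega) r1 ((hpQ r1).1 (by simp)) a ha
    have i1 := m1.inj hp
    have hdA := Finset.disjoint_left.1 hv.disj ha
    have m2 := hf p1 i1 (fun r => by
      have h1 := hpQ r
      have h2 := s1.mem_iff (Finset.Subset.refl _) r
      have h3 : p1 r = a ↔ r = r1 := ⟨fun h => i1 (h.trans e1.symm), fun h => h ▸ e1⟩
      have h4 : a ≠ w := fun h => hwA (h ▸ ha)
      have h5 : a ≠ x := fun h => hv.xA (h ▸ ha)
      rw [← h2] at h1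
      simp only [HH, Finset.mem_insert, Finset.mem_union, Finset.mem_erase] at h1 ⊢
      grind)
    have : (fun r => if r ∈ insert r1 Q' then Function.update f r1 a r else p r)
        = (fun r => if r ∈ Q' then f r else p1 r) := by
      ext r
      by_cases h : r = r1
      · subst h; simp [hr1, e1]
      · by_cases h' : r ∈ Q'
        · simp [h', h]
        · have h1 : p r ∉ HH w x A B := by rw [← hpQ]; simp [h, h']
          have := s1 r
          simp only [Finset.mem_insert, h, h']
          grind
    rw [this]
    exact m1.trans' m2 (by ring_nf; omega)

theorem Hv.reconf {w x : V} {A B : Finset V} (hv : Hv G k w x A B) (hA : k ≤ A.card)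
    (hB : k ≤ B.card) {p q : Fin k → V} (hp : Function.Injective p) (hq : Function.Injective q)
    (hs : Supp (HH w x A B) p q) : Mv G (22 * k ^ 3) p q := by
  set Q := Finset.univ.filter (fun r => p r ∈ HH w x A B) with hQ
  have hQk : Q.card ≤ k := cnt_le_k _ _
  obtain ⟨f, hf⟩ := Hv.canon Q.card A hv (by omega) (by omega) Q rfl
  have h1 := hf p hp (fun r => by simp [hQ])
  have h2 := hf q hq (fun r => by simp [hQ, hs.mem_iff (Finset.Subset.refl _)])
  have : (fun r => if r ∈ Q then f r else q r) = (fun r => if r ∈ Q then f r else p r) := by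
    ext r
    by_cases h : r ∈ Q
    · simp [h]
    · have := hs r
      simp only [h]
      simp [hQ] at h
      grind
  rw [this] at h2
  refine h1.trans' h2.symm ?_
  have : Q.card * (11 * k ^ 2) ≤ k * (11 * k ^ 2) := Nat.mul_le_mul_right _ hQk
  calc _ ≤ k * (11 * k ^ 2) + k * (11 * k ^ 2) := by omega
    _ = _ := by ring

theorem exists_placement {H F : Finset V} {Y : Finset (Fin k)} (g : Fin k → V)
    (hg : ∀ r r', r ∉ Y → r' ∉ Y → g r = g r' → r = r') (hH : 2 * k ≤ H.card) (hF : F.card ≤ k) :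
    ∃ q : Fin k → V, Function.Injective q ∧ (∀ r, r ∉ Y → q r = g r) ∧
      ∀ r, r ∈ Y → q r ∈ H ∧ q r ∉ F := by
  set P : Finset V := H \ (F ∪ Yᶜ.image g) with hP
  have hcard : Y.card ≤ P.card := by
    have h1 := Finset.le_card_sdiff (F ∪ Yᶜ.image g) H
    have h2 := Finset.card_union_le F (Yᶜ.image g)
    have h3 : (Yᶜ.image g).card ≤ Yᶜ.card := Finset.card_image_le
    have h4 : Yᶜ.card = k - Y.card := by rw [Finset.card_compl]; simp
    have h5 : Y.card ≤ k := by simpa using Finset.card_le_univ Y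
    rw [← hP] at h1
    omega
  obtain ⟨φ⟩ : Nonempty (Y ↪ P) := Function.Embedding.nonempty_of_card_le (by simpa using hcard)
  have hφ : ∀ y : Y, (φ y : V) ∈ H ∧ (φ y : V) ∉ F ∧ ∀ r, r ∉ Y → g r ≠ (φ y : V) := by
    intro y
    have : ∀ v ∈ P, v ∈ H ∧ v ∉ F ∧ ∀ r, r ∉ Y → g r ≠ v := by
      intro v hv
      rw [hP] at hv
      simp at hv
      tauto
    exact this _ (φ y).2
  refine ⟨fun r => if h : r ∈ Y then φ ⟨r, h⟩ else g r, ?_, ?_, ?_⟩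
  · intro r r' h
    by_cases h1 : r ∈ Y <;> by_cases h2 : r' ∈ Y
    · simp only [h1, h2, dif_pos] at h
      have := φ.injective (Subtype.ext h)
      simpa using this
    · simp only [h1, h2, dif_pos, dif_neg, not_false_eq_true] at h
      exact absurd h.symm ((hφ ⟨r, h1⟩).2.2 r' h2)
    · simp only [h1, h2, dif_pos, dif_neg, not_false_eq_true] at h
      exact absurd h ((hφ ⟨r', h2⟩).2.2 r h1)
    · simp [h1, h2] at h
      exact hg r r' h1 h2 h
  · intro r hr; simp [hr]
  · intro r hr
    have := hφ ⟨r, hr⟩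
    simp only [hr, dif_pos]; exact ⟨this.1, this.2.1⟩

theorem Mv.toSeq {n : ℕ} {c c' : Fin k → V} (h : Mv G n c c') (hc : Function.Injective c) :
    ∃ (T : ℕ) (pos : ℕ → Fin k → V), pos 0 = c ∧ pos T = c' ∧
      (∀ t ≤ T, Function.Injective (pos t)) ∧
      (∀ t < T, Stp G (pos t) (pos (t + 1))) ∧
      ∑ t ∈ Finset.range T, cst (pos t) (pos (t + 1)) ≤ n := by
  induction h with
  | refl n c => exact ⟨0, fun _ => c, rfl, rfl, fun _ _ => hc, by simp, by simp⟩
  | @tail n m c c' c'' h1 h2 h3 ih =>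
    obtain ⟨T, pos, p0, pT, pi, ps, pc⟩ := ih hc
    refine ⟨T + 1, fun t => if t ≤ T then pos t else c'', by simp [p0], by simp, ?_, ?_, ?_⟩
    · intro t ht
      by_cases h : t ≤ T
      · simp [h]; exact pi t h
      · simp [h]; exact h2.2.1
    · intro t ht
      by_cases h : t + 1 ≤ T
      · have : t ≤ T := by omega
        simp [h, this]; exact ps t (by omega)
      · have : t = T := by omega
        subst this
        simp [pT]; exact h2
    · rw [Finset.sum_range_succ]
      have : ∑ t ∈ Finset.range T, cst (if t ≤ T then pos t else c'') (if t + 1 ≤ T then pos (t + 1) else c'')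
          = ∑ t ∈ Finset.range T, cst (pos t) (pos (t + 1)) := by
        refine Finset.sum_congr rfl fun t ht => ?_
        have := Finset.mem_range.1 ht
        rw [if_pos (by omega), if_pos (by omega)]
      rw [this]
      simp [pT]
      omega

theorem routeLength_eq {I : Inst V G k} (S : Sched I) (i : Fin k) :
    routeLength S i = ∑ t ∈ Finset.range S.T, if S.pos t i ≠ S.pos (t + 1) i then 1 else 0 := by
  unfold routeLength
  rw [← Finset.card_filter, ← Set.ncard_coe_finset]
  congr 1
  ext t; simp

theorem totalLength_eq {I : Inst V G k} (S : Sched I) :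
    totalLength S = ∑ t ∈ Finset.range S.T, cst (S.pos t) (S.pos (t + 1)) := by
  unfold totalLength
  simp_rw [routeLength_eq]
  rw [Finset.sum_comm]
  refine Finset.sum_congr rfl fun t _ => ?_
  rw [cst, Finset.card_filter]

theorem Mv.toSched {I : Inst V G k} {n : ℕ} {c : Fin k → V} (h : Mv G n I.start c)
    (hc : ∀ i, I.isM i → c i = I.dest i) : ∃ S : Sched I, totalLength S ≤ n := by
  obtain ⟨T, pos, p0, pT, pi, ps, pc⟩ := h.toSeq I.start_inj
  refine ⟨⟨T, pos, fun i => by rw [p0], fun i hi => by rw [pT]; exact hc i hi,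
    fun j hj i => (ps j hj).2.2.1 i, pi, fun j hj => (ps j hj).2.2.2⟩, ?_⟩
  rw [totalLength_eq]; exact pc

open scoped Classical in
theorem Hv.parkGen {w x : V} {A B : Finset V} (hv : Hv G k w x A B) (hA : k ≤ A.card)
    (hB : k ≤ B.card) {I : Inst V G k} (S : Sched I) (Pk : ℕ → Fin k → Prop)
    (ha : ∀ t ≤ S.T, ∀ j, ¬ Pk t j → S.pos t j ∉ HH w x A B)
    (hb : ∀ t < S.T, ∀ j, Pk t j → ¬ Pk (t + 1) j → S.pos t j ∈ HH w x A B)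
    (hc : ∀ t < S.T, ∀ j, ¬ Pk t j → Pk (t + 1) j → S.pos (t + 1) j ∈ HH w x A B)
    (hd : ∀ j, Pk S.T j → I.isM j → S.pos S.T j ∈ HH w x A B)
    (n0 : ℕ) (c0 : Fin k → V) (hm0 : Mv G n0 I.start c0)
    (h0 : ∀ j, (Pk 0 j → c0 j ∈ HH w x A B) ∧ (¬ Pk 0 j → c0 j = I.start j))
    (E : ℕ) (hE : ((Finset.range S.T).filter (fun t => ∃ j, ¬ (Pk t j ↔ Pk (t + 1) j))).card ≤ E) :
    ∃ S' : Sched I, totalLength S' ≤ n0 + (∑ t ∈ Finset.range S.T,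
      (Finset.univ.filter (fun r => ¬ (Pk t r ∧ Pk (t + 1) r) ∧ S.pos t r ≠ S.pos (t + 1) r)).card)
      + 22 * k ^ 3 * (E + 1) := by
  have hHc : 2 * k ≤ (HH w x A B).card := by
    have h1 : (A ∪ B).card ≤ (HH w x A B).card := Finset.card_le_card (by unfold HH; grind)
    rw [Finset.card_union_of_disjoint hv.disj] at h1
    omega
  set H := HH w x A B with hH
  set mv : ℕ → ℕ := fun t => (Finset.univ.filter (fun r => ¬ (Pk t r ∧ Pk (t + 1) r) ∧ S.pos t r ≠ S.pos (t + 1) r)).card with hmv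
  set ev : ℕ → ℕ := fun t => if ∃ j, ¬ (Pk t j ↔ Pk (t + 1) j) then 22 * k ^ 3 else 0 with hev
  have main : ∀ t ≤ S.T, ∃ c : Fin k → V,
      (∀ j, (Pk t j → c j ∈ H) ∧ (¬ Pk t j → c j = S.pos t j)) ∧
      Mv G (n0 + ∑ s ∈ Finset.range t, (mv s + ev s)) I.start c := by
    intro t
    induction t with
    | zero =>
      intro _
      refine ⟨c0, fun j => ⟨(h0 j).1, fun h => by rw [S.init]; exact (h0 j).2 h⟩, by simpa using hm0⟩
    | succ t ih =>
      intro ht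
      obtain ⟨c, hc1, hc2⟩ := ih (by omega)
      have ic := hc2.inj I.start_inj
      set Y : Finset (Fin k) := Finset.univ.filter (fun r => Pk t r ∧ Pk (t + 1) r) with hY
      have hYm : ∀ r, r ∈ Y ↔ (Pk t r ∧ Pk (t + 1) r) := fun r => by simp [hY]
      have hq : ∃ q : Fin k → V, Mv G (ev t) c q ∧ Function.Injective q ∧
          (∀ r, r ∉ Y → q r = S.pos t r) ∧ (∀ r, r ∈ Y → q r ∈ H) ∧
          ∀ r r', r ∈ Y → r' ∉ Y → q r ≠ S.pos (t + 1) r' := by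
        by_cases he : ∃ j, ¬ (Pk t j ↔ Pk (t + 1) j)
        · obtain ⟨q, q1, q2, q3⟩ := exists_placement (H := H)
            (F := Finset.univ.image (S.pos (t + 1))) (Y := Y) (S.pos t)
            (fun r r' _ _ h => S.noVertexConflict t (by omega) h) hHc
            (Finset.card_image_le.trans (by simp))
          refine ⟨q, ?_, q1, q2, fun r hr => (q3 r hr).1, fun r r' hr _ h => (q3 r hr).2 (by simp [h])⟩
          simp only [hev, he, if_true]
          refine hv.reconf hA hB ic q1 fun r => ?_
          by_cases hr : r ∈ Y
          · exact Or.inl ⟨(hc1 r).1 ((hYm r).1 hr).1, (q3 r hr).1⟩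
          · by_cases hp : Pk t r
            · left
              refine ⟨(hc1 r).1 hp, ?_⟩
              rw [q2 r hr]
              exact hb t (by omega) r hp (fun h => hr ((hYm r).2 ⟨hp, h⟩))
            · right; rw [q2 r hr, (hc1 r).2 hp]
        · push Not at he
          refine ⟨c, Mv.refl _ _, ic, fun r hr => (hc1 r).2 fun h => hr ((hYm r).2 ⟨h, (he r).1 h⟩),
            fun r hr => (hc1 r).1 ((hYm r).1 hr).1, fun r r' hr hr' h => ?_⟩
          have h1 := (hc1 r).1 ((hYm r).1 hr).1
          rw [h] at h1
          exact ha (t + 1) ht r' (fun h => hr' ((hYm r').2 ⟨(he r').2 h, h⟩)) h1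
      obtain ⟨q, m1, q1, q2, q3, q4⟩ := hq
      refine ⟨fun r => if r ∈ Y then q r else S.pos (t + 1) r, fun j => ⟨fun hp => ?_, fun hp => ?_⟩, ?_⟩
      · by_cases hj : j ∈ Y
        · simp [hj, q3 j hj]
        · simp [hj]
          exact hc t (by omega) j (fun h => hj ((hYm j).2 ⟨h, hp⟩)) hp
      · have : j ∉ Y := fun h => hp ((hYm j).1 h).2
        simp [this]
      · have hstp : Stp G q (fun r => if r ∈ Y then q r else S.pos (t + 1) r) := by
          refine ⟨q1, ?_, ?_, ?_⟩
          · intro r r' h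
            by_cases h1 : r ∈ Y <;> by_cases h2 : r' ∈ Y <;> simp [h1, h2] at h
            · exact q1 h
            · exact absurd h (q4 r r' h1 h2)
            · exact absurd h.symm (q4 r' r h2 h1)
            · exact S.noVertexConflict (t + 1) ht h
          · intro r
            by_cases h1 : r ∈ Y
            · simp [h1]
            · simp only [h1, if_false]; rw [q2 r h1]; exact S.step t (by omega) r
          · rintro r r' hr ⟨h1, h2⟩
            by_cases h3 : r ∈ Y
            · simp [h3] at h1; exact hr (q1 h1)
            by_cases h4 : r' ∈ Y
            · simp [h4] at h2; exact hr (q1 h2.symm)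
            simp only [h3, h4, if_false] at h1 h2
            rw [q2 r' h4] at h1; rw [q2 r h3] at h2
            exact S.noSwap t (by omega) r r' hr ⟨h1, h2⟩
        have hcst : cst q (fun r => if r ∈ Y then q r else S.pos (t + 1) r) ≤ mv t := by
          refine Finset.card_le_card fun r hr => ?_
          simp only [Finset.mem_filter, Finset.mem_univ, true_and] at hr ⊢
          by_cases h1 : r ∈ Y
          · simp [h1] at hr
          · simp only [h1, if_false] at hr; rw [q2 r h1] at hr
            exact ⟨fun h => h1 ((hYm r).2 h), hr⟩
        refine Mv.tail (hc2.trans m1) hstp ?_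
        rw [Finset.sum_range_succ]; omega
  obtain ⟨c, hc1, hc2⟩ := main S.T le_rfl
  have ic := hc2.inj I.start_inj
  obtain ⟨q, q1, q2, q3⟩ := exists_placement (H := H) (F := ∅)
    (Y := Finset.univ.filter (fun r => Pk S.T r ∧ ¬ I.isM r)) (S.pos S.T)
            (fun r r' _ _ h => S.noVertexConflict S.T le_rfl h) hHc (by simp)
  have m1 : Mv G (22 * k ^ 3) c q := by
    refine hv.reconf hA hB ic q1 fun r => ?_
    by_cases hr : Pk S.T r
    · left
      refine ⟨(hc1 r).1 hr, ?_⟩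
      by_cases hM : I.isM r
      · rw [q2 r (by simp [hM])]; exact hd r hr hM
      · exact (q3 r (by simp [hr, hM])).1
    · right; rw [q2 r (by simp [hr]), (hc1 r).2 hr]
  obtain ⟨S', hS'⟩ := (hc2.trans m1).toSched (fun i hi => by
    rw [q2 i (by simp [hi])]; exact S.final i hi)
  refine ⟨S', hS'.trans ?_⟩
  change _ ≤ n0 + (∑ t ∈ Finset.range S.T, mv t) + _
  rw [Finset.sum_add_distrib]
  have : ∑ t ∈ Finset.range S.T, ev t ≤ 22 * k ^ 3 * E := by
    simp only [hev]
    rw [← Finset.sum_filter, Finset.sum_const, smul_eq_mul, mul_comm]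
    exact Nat.mul_le_mul_left _ hE
  rw [mul_add]; omega

def Pk0 {I : Inst V G k} (S : Sched I) (H : Finset V) (t : ℕ) (j : Fin k) : Prop :=
  (∃ s ≤ t, S.pos s j ∈ H) ∧ ∃ s, t ≤ s ∧ s ≤ S.T ∧ S.pos s j ∈ H

theorem Pk0.exit {I : Inst V G k} {S : Sched I} {H : Finset V} {t : ℕ} {j : Fin k}
    (h : Pk0 S H t j) (h' : ¬ Pk0 S H (t + 1) j) :
    S.pos t j ∈ H ∧ ∀ s, t < s → s ≤ S.T → S.pos s j ∉ H := by
  obtain ⟨⟨s, hs, hsH⟩, s', hs', hsT, hsH'⟩ := h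
  have h2 : ∀ u, t < u → u ≤ S.T → S.pos u j ∉ H := fun u hu huT huH =>
    h' ⟨⟨s, by omega, hsH⟩, u, by omega, huT, huH⟩
  refine ⟨?_, h2⟩
  rcases hs'.lt_or_eq with h | h
  · exact absurd hsH' (h2 s' h hsT)
  · rw [h]; exact hsH'

theorem Pk0.enter {I : Inst V G k} {S : Sched I} {H : Finset V} {t : ℕ} {j : Fin k}
    (h : Pk0 S H (t + 1) j) (h' : ¬ Pk0 S H t j) :
    S.pos (t + 1) j ∈ H ∧ ∀ s, s ≤ t → S.pos s j ∉ H := by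
  obtain ⟨⟨s, hs, hsH⟩, s', hs', hsT, hsH'⟩ := h
  have h2 : ∀ u, u ≤ t → S.pos u j ∉ H := fun u hu huH =>
    h' ⟨⟨u, hu, huH⟩, s', by omega, hsT, hsH'⟩
  refine ⟨?_, h2⟩
  rcases hs.lt_or_eq with h | h
  · exact absurd hsH (h2 s (by omega))
  · rw [← h]; exact hsH

open scoped Classical in
theorem Hv.park {w x : V} {A B : Finset V} (hv : Hv G k w x A B) (hA : k ≤ A.card)
    (hB : k ≤ B.card) {I : Inst V G k} (S : Sched I) (sp : Fin k → Prop)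
    (hsp : ∀ j, sp j → ¬ I.isM j)
    (n0 : ℕ) (c0 : Fin k → V) (hm0 : Mv G n0 I.start c0)
    (h0 : ∀ j, (sp j → c0 j ∈ HH w x A B) ∧ (I.start j ∈ HH w x A B → c0 j ∈ HH w x A B) ∧
      (¬ sp j → I.start j ∉ HH w x A B → c0 j = I.start j)) :
    ∃ S' : Sched I, totalLength S' ≤ n0 + (∑ t ∈ Finset.range S.T,
      (Finset.univ.filter (fun r => ¬ ((sp r ∨ Pk0 S (HH w x A B) t r) ∧
        (sp r ∨ Pk0 S (HH w x A B) (t + 1) r)) ∧ S.pos t r ≠ S.pos (t + 1) r)).card)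
      + 22 * k ^ 3 * (2 * k + 1) := by
  set H := HH w x A B with hH
  have key := hv.parkGen hA hB S (fun t r => sp r ∨ Pk0 S H t r)
  refine Exists.imp (fun S' h => by convert h) (key ?_ ?_ ?_ ?_ n0 c0 hm0 ?_ (2 * k) ?_)
  · intro t ht j hj hp
    exact hj (Or.inr ⟨⟨t, le_rfl, hp⟩, t, le_rfl, ht, hp⟩)
  · intro t ht j h1 h2
    push Not at h2
    exact (Pk0.exit (h1.resolve_left h2.1) h2.2).1
  · intro t ht j h1 h2
    push Not at h1
    exact (Pk0.enter (h2.resolve_left h1.1) h1.2).1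
  · intro j h1 h2
    obtain ⟨-, s, hs, hs', h⟩ := h1.resolve_left (fun h => hsp j h h2)
    have : s = S.T := by omega
    rwa [this] at h
  · intro j
    constructor
    · rintro (h | ⟨⟨s, hs, h⟩, -⟩)
      · exact (h0 j).1 h
      · have : s = 0 := by omega
        rw [this, S.init] at h
        exact (h0 j).2.1 h
    · intro h
      push Not at h
      refine (h0 j).2.2 h.1 fun h' => h.2 ?_
      rw [← S.init] at h'
      exact ⟨⟨0, le_rfl, h'⟩, 0, le_rfl, by omega, h'⟩
  · have hsub : ((Finset.range S.T).filter (fun t => ∃ j, ¬ ((sp j ∨ Pk0 S H t j) ↔ (sp j ∨ Pk0 S H (t + 1) j)))) ⊆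
        Finset.univ.biUnion (fun j : Fin k =>
          (Finset.range S.T).filter (fun t => Pk0 S H t j ∧ ¬ Pk0 S H (t + 1) j) ∪
          (Finset.range S.T).filter (fun t => Pk0 S H (t + 1) j ∧ ¬ Pk0 S H t j)) := by
      intro t ht
      simp only [Finset.mem_filter, Finset.mem_biUnion, Finset.mem_univ, true_and, Finset.mem_union] at ht ⊢
      obtain ⟨ht, j, hj⟩ := ht
      exact ⟨j, by tauto⟩
    have hsub' := Finset.card_le_card hsub
    refine le_trans (le_of_eq (by congr)) (hsub'.trans (Finset.card_biUnion_le.trans ?_))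
    refine (Finset.sum_le_card_nsmul _ _ 2 fun j _ => ?_).trans (by simp; omega)
    refine (Finset.card_union_le _ _).trans ?_
    have e1 : ((Finset.range S.T).filter (fun t => Pk0 S H t j ∧ ¬ Pk0 S H (t + 1) j)).card ≤ 1 := by
      rw [Finset.card_le_one]
      intro a ha b hb
      simp only [Finset.mem_filter, Finset.mem_range] at ha hb
      have h1 := Pk0.exit ha.2.1 ha.2.2
      have h2 := Pk0.exit hb.2.1 hb.2.2
      by_contra hne
      rcases Nat.lt_or_gt_of_ne hne with h | h
      · exact h1.2 b h (by omega) h2.1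
      · exact h2.2 a h (by omega) h1.1
    have e2 : ((Finset.range S.T).filter (fun t => Pk0 S H (t + 1) j ∧ ¬ Pk0 S H t j)).card ≤ 1 := by
      rw [Finset.card_le_one]
      intro a ha b hb
      simp only [Finset.mem_filter, Finset.mem_range] at ha hb
      have h1 := Pk0.enter ha.2.1 ha.2.2
      have h2 := Pk0.enter hb.2.1 hb.2.2
      by_contra hne
      rcases Nat.lt_or_gt_of_ne hne with h | h
      · exact h2.2 (a + 1) (by omega) h1.1
      · exact h1.2 (b + 1) (by omega) h2.1
    omega

theorem Hv.unvisited {w x : V} {A B : Finset V} (hv : Hv G k w x A B) (hA : k ≤ A.card)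
    (hB : k ≤ B.card) {I : Inst V G k} (S : Sched I) (hS : Optimal S)
    (hcard : k + 22 * k ^ 3 * (2 * k + 1) < (HH w x A B).card) :
    ∃ h ∈ HH w x A B, ∀ t ≤ S.T, ∀ r, S.pos t r ≠ h := by
  classical
  obtain ⟨S', hS'⟩ := hv.park hA hB S (fun _ => False) (fun _ h => h.elim) 0 I.start (Mv.refl _ _)
    (fun j => ⟨fun h => h.elim, id, fun _ _ => rfl⟩)
  have hle := (hS S').trans hS'
  set H := HH w x A B with hH
  rw [totalLength_eq] at hle
  set Z : Finset (ℕ × Fin k) := (Finset.range S.T ×ˢ Finset.univ).filter (fun p =>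
    (Pk0 S H p.1 p.2 ∧ Pk0 S H (p.1 + 1) p.2) ∧ S.pos p.1 p.2 ≠ S.pos (p.1 + 1) p.2) with hZ
  have hZc : Z.card = ∑ t ∈ Finset.range S.T, (Finset.univ.filter (fun r =>
      (Pk0 S H t r ∧ Pk0 S H (t + 1) r) ∧ S.pos t r ≠ S.pos (t + 1) r)).card := by
    rw [hZ, Finset.card_filter, Finset.sum_product]
    refine Finset.sum_congr rfl fun t _ => ?_
    rw [Finset.card_filter]
  have hsum : ∀ t, cst (S.pos t) (S.pos (t + 1)) =
      (Finset.univ.filter (fun r => (Pk0 S H t r ∧ Pk0 S H (t + 1) r) ∧ S.pos t r ≠ S.pos (t + 1) r)).card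
      + (Finset.univ.filter (fun r => ¬ ((False ∨ Pk0 S H t r) ∧
        (False ∨ Pk0 S H (t + 1) r)) ∧ S.pos t r ≠ S.pos (t + 1) r)).card := by
    intro t
    rw [cst, ← Finset.card_filter_add_card_filter_not (fun r => Pk0 S H t r ∧ Pk0 S H (t + 1) r),
      Finset.filter_filter, Finset.filter_filter]
    congr 2
    · ext r; simp only [Finset.mem_filter]; tauto
    · ext r; simp only [Finset.mem_filter]; tauto
  have hZle : Z.card ≤ 22 * k ^ 3 * (2 * k + 1) := by
    have h1 : ∑ t ∈ Finset.range S.T, cst (S.pos t) (S.pos (t + 1)) = Z.card +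
      ∑ t ∈ Finset.range S.T, (Finset.univ.filter (fun r => ¬ ((False ∨ Pk0 S H t r) ∧
        (False ∨ Pk0 S H (t + 1) r)) ∧ S.pos t r ≠ S.pos (t + 1) r)).card := by
      rw [hZc, ← Finset.sum_add_distrib]
      exact Finset.sum_congr rfl fun t _ => hsum t
    have h2 : ∑ t ∈ Finset.range S.T, cst (S.pos t) (S.pos (t + 1)) ≤ 0 +
      (∑ t ∈ Finset.range S.T, (Finset.univ.filter (fun r => ¬ ((False ∨ Pk0 S H t r) ∧
        (False ∨ Pk0 S H (t + 1) r)) ∧ S.pos t r ≠ S.pos (t + 1) r)).card) +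
        22 * k ^ 3 * (2 * k + 1) := hle.trans (le_of_eq (by congr!))
    omega
  have hfirst : ∀ r : Fin k, ∃ v : V, ∀ t ≤ S.T, S.pos t r ∈ H → (∀ s < t, S.pos s r ∉ H) →
      S.pos t r = v := by
    intro r
    by_cases h : ∃ t, t ≤ S.T ∧ S.pos t r ∈ H ∧ ∀ s < t, S.pos s r ∉ H
    · obtain ⟨t, ht, h1, h2⟩ := h
      refine ⟨S.pos t r, fun t' ht' h1' h2' => ?_⟩
      rcases lt_trichotomy t t' with h | h | h
      · exact absurd h1 (h2' t h)
      · rw [h]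
      · exact absurd h1' (h2 t' h)
    · refine ⟨w, fun t h1 h2 h3 => absurd ⟨t, h1, h2, h3⟩ h⟩
  choose fv hfv using hfirst
  by_contra hcon
  push Not at hcon
  have hsub : H ⊆ Finset.univ.image fv ∪ Z.image (fun p => S.pos (p.1 + 1) p.2) := by
    intro h hh
    obtain ⟨t0, ht0, r, hr0⟩ := hcon h hh
    have hex : ∃ t, S.pos t r = h := ⟨t0, hr0⟩
    have hmin : ∀ s < Nat.find hex, S.pos s r ≠ h := fun s hs => Nat.find_min hex hs
    have hspec : S.pos (Nat.find hex) r = h := Nat.find_spec hex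
    have hleT : Nat.find hex ≤ S.T := (Nat.find_min' hex hr0).trans ht0
    generalize Nat.find hex = t at hmin hspec hleT
    rw [Finset.mem_union]
    by_cases hf : ∀ s < t, S.pos s r ∉ H
    · left
      rw [Finset.mem_image]
      exact ⟨r, Finset.mem_univ _, by rw [← hspec]; exact (hfv r t hleT (by rw [hspec]; exact hh) hf).symm⟩
    · right
      push Not at hf
      obtain ⟨s0, hs0, hs0H⟩ := hf
      obtain ⟨s, rfl⟩ : ∃ s, t = s + 1 := ⟨t - 1, by omega⟩
      rw [Finset.mem_image]
      have hm : S.pos (s + 1) r ∈ H := by rw [hspec]; exact hh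
      refine ⟨(s, r), ?_, hspec⟩
      rw [hZ, Finset.mem_filter]
      refine ⟨by simp; omega, ⟨⟨⟨s0, by omega, hs0H⟩, s + 1, by omega, hleT, hm⟩,
        ⟨s + 1, le_rfl, hm⟩, s + 1, le_rfl, hleT, hm⟩, ?_⟩
      simp only
      rw [hspec]; exact hmin s (by omega)
  have h1 := Finset.card_le_card hsub
  have h2 := Finset.card_union_le (Finset.univ.image fv) (Z.image (fun p => S.pos (p.1 + 1) p.2))
  have h3 : (Finset.univ.image fv).card ≤ k := Finset.card_image_le.trans (by simp)
  have h4 : (Z.image (fun p => S.pos (p.1 + 1) p.2)).card ≤ Z.card := Finset.card_image_le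
  omega

theorem Hv.clearV {w x : V} {A B : Finset V} (hv : Hv G k w x A B) (hA : k ≤ A.card)
    (hB : k ≤ B.card) (hk : 1 ≤ k) {p : Fin k → V} (hp : Function.Injective p) (y : V) :
    ∃ q, Mv G (22 * k ^ 3) p q ∧ Supp (HH w x A B) p q ∧ (y ∈ HH w x A B → ∀ s, q s ≠ y) := by
  have hHc : 2 * k ≤ (HH w x A B).card := by
    have h1 : (A ∪ B).card ≤ (HH w x A B).card := Finset.card_le_card (by unfold HH; grind)
    rw [Finset.card_union_of_disjoint hv.disj] at h1
    omega
  obtain ⟨q, q1, q2, q3⟩ := exists_placement (H := HH w x A B) (F := {y})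
    (Y := Finset.univ.filter (fun r => p r ∈ HH w x A B)) p (fun r r' _ _ h => hp h) hHc (by simpa using hk)
  have hs : Supp (HH w x A B) p q := by
    intro r
    by_cases h : p r ∈ HH w x A B
    · exact Or.inl ⟨h, (q3 r (by simp [h])).1⟩
    · exact Or.inr (q2 r (by simp [h]))
  refine ⟨q, hv.reconf hA hB hp q1 hs, hs, fun hy s hsy => ?_⟩
  by_cases h : p s ∈ HH w x A B
  · have := (q3 s (by simp [h])).2
    simp at this; exact this hsy
  · have := q2 s (by simp [h])
    rw [← this, hsy] at h; exact h hy

theorem Hv.walkIn {w x : V} {A B : Finset V} (hv : Hv G k w x A B) (hA : k ≤ A.card)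
    (hB : k ≤ B.card) (f : ℕ → V) (hf0 : f 0 ∈ HH w x A B) (r : Fin k) (n : ℕ) 
    (hfa : ∀ m < n, G.Adj (f (m + 1)) (f m)) :
    ∀ p : Fin k → V, Function.Injective p →
    p r = f n → f n ∉ HH w x A B → (∀ m < n, f m ∉ HH w x A B → ∀ s, s ≠ r → p s ≠ f m) →
    ∃ q, Mv G (n + 22 * k ^ 3) p q ∧ q r ∈ HH w x A B ∧
      ∀ s, s ≠ r → (p s ∈ HH w x A B ∧ q s ∈ HH w x A B) ∨ q s = p s := by
  have hk : 1 ≤ k := by have := r.2; omega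
  induction n with
  | zero => intro p _ _ h; exact absurd hf0 h
  | succ n ih =>
    intro p hp hpr hn he
    by_cases hin : f n ∈ HH w x A B
    · obtain ⟨q, m1, s1, e1⟩ := hv.clearV hA hB hk hp (f n)
      have hqr : q r = f (n + 1) := by
        have := s1 r
        rw [hpr] at this
        exact this.resolve_left (fun h => hn h.1)
      refine ⟨Function.update q r (f n), m1.trans' (Mv.one (m1.inj hp) (by rw [hqr]; exact hfa n (by omega)) (e1 hin)) (by omega), by simpa using hin, fun s hs => ?_⟩
      rw [Function.update_of_ne hs]; exact s1 s
    · have m1 := Mv.one hp (r := r) (v := f n) (by rw [hpr]; exact hfa n (by omega)) (fun s => by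
        by_cases hs : s = r
        · subst hs; rw [hpr]; exact (hfa n (by omega)).ne
        · exact he n (by omega) hin s hs)
      obtain ⟨q, m2, q1, q2⟩ := ih (fun m hm => hfa m (by omega)) (Function.update p r (f n)) (m1.inj hp) (by simp) hin (fun m hm hmH s hs => by
        rw [Function.update_of_ne hs]; exact he m (by omega) hmH s hs)
      refine ⟨q, m1.trans' m2 (by omega), q1, fun s hs => ?_⟩
      have := q2 s hs
      rw [Function.update_of_ne hs] at this
      exact this

theorem Hv.clearPath {w x : V} {A B : Finset V} (hv : Hv G k w x A B) (hA : k ≤ A.card)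
    (hB : k ≤ B.card) (f : ℕ → V) (hf0 : f 0 ∈ HH w x A B) (lam : ℕ) (n : ℕ) (hn : n ≤ lam)
    (hfa : ∀ m < n, G.Adj (f (m + 1)) (f m)) (p : Fin k → V) (hp : Function.Injective p) :
    ∃ q N, Mv G N p q ∧ N + (lam + 22 * k ^ 3) * cnt p (HH w x A B) ≤
        (lam + 22 * k ^ 3) * cnt q (HH w x A B) ∧
      (∀ s, p s ∈ HH w x A B → q s ∈ HH w x A B) ∧ (∀ s, q s ∈ HH w x A B ∨ q s = p s) ∧
      (∀ m ≤ n, f m ∉ HH w x A B → ∀ s, q s ≠ f m) ∧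
      (∀ s, q s ∈ HH w x A B → p s ∈ HH w x A B ∨ ∃ m ≤ n, p s = f m) := by
  induction n with
  | zero =>
    refine ⟨p, 0, Mv.refl _ _, by omega, fun _ h => h, fun _ => Or.inr rfl, ?_, fun _ h => Or.inl h⟩
    intro m hm h
    have : m = 0 := by omega
    subst this; exact absurd hf0 h
  | succ n ih =>
    obtain ⟨q, N, m1, hN, q1, q2, q3, q4⟩ := ih (by omega) (fun m hm => hfa m (by omega))
    have iq := m1.inj hp
    by_cases hocc : f (n + 1) ∉ HH w x A B ∧ ∃ r, q r = f (n + 1)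
    · obtain ⟨hnH, r, hr⟩ := hocc
      obtain ⟨q', m2, e1, e2⟩ := hv.walkIn hA hB f hf0 r (n + 1) hfa q iq hr hnH
        (fun m hm hmH s _ => q3 m (by omega) hmH s)
      have hlt : cnt q (HH w x A B) < cnt q' (HH w x A B) := by
        refine cnt_lt (fun s hs => ?_) r (by rw [hr]; exact hnH) e1
        by_cases hsr : s = r
        · rw [hsr]; exact e1
        · rcases e2 s hsr with h | h
          · exact h.2
          · rw [h]; exact hs
      refine ⟨q', N + (n + 1 + 22 * k ^ 3), m1.trans m2, ?_, ?_, ?_, ?_, ?_⟩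
      · have : (lam + 22 * k ^ 3) * (cnt q (HH w x A B) + 1) ≤ (lam + 22 * k ^ 3) * cnt q' (HH w x A B) :=
          Nat.mul_le_mul_left _ hlt
        rw [mul_add] at this
        omega
      · intro s hs
        by_cases hsr : s = r
        · rw [hsr]; exact e1
        · rcases e2 s hsr with h | h
          · exact h.2
          · rw [h]; exact q1 s hs
      · intro s
        by_cases hsr : s = r
        · rw [hsr]; exact Or.inl e1
        · rcases e2 s hsr with h | h
          · exact Or.inl h.2
          · rw [h]; exact q2 s
      · intro m hm hmH s hs
        by_cases hsr : s = r
        · rw [hsr] at hs; rw [hs] at e1; exact hmH e1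
        · rcases e2 s hsr with h | h
          · rw [hs] at h; exact hmH h.2
          · rw [h] at hs
            rcases hm.lt_or_eq with h' | h'
            · exact q3 m (by omega) hmH s hs
            · rw [h'] at hs; exact hsr (iq (hs.trans hr.symm))
      · intro s hs
        by_cases hsr : s = r
        · right
          refine ⟨n + 1, le_rfl, ?_⟩
          rcases q2 r with h | h
          · rw [hr] at h; exact absurd h hnH
          · rw [hsr, ← h, hr]
        · have : q s ∈ HH w x A B := by
            rcases e2 s hsr with h | h
            · exact h.1
            · rw [← h]; exact hs
          rcases q4 s this with h | ⟨m, hm, h⟩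
          · exact Or.inl h
          · exact Or.inr ⟨m, by omega, h⟩
    · refine ⟨q, N, m1, hN, q1, q2, ?_, ?_⟩
      · intro m hm hmH s hs
        rcases hm.lt_or_eq with h' | h'
        · exact q3 m (by omega) hmH s hs
        · subst h'; exact hocc ⟨hmH, s, hs⟩
      · intro s hs
        rcases q4 s hs with h | ⟨m, hm, h⟩
        · exact Or.inl h
        · exact Or.inr ⟨m, by omega, h⟩

theorem Hv.bringIn {w x : V} {A B : Finset V} (hv : Hv G k w x A B) (hA : k ≤ A.card)
    (hB : k ≤ B.card) (f : ℕ → V) (hf0 : f 0 ∈ HH w x A B) (lam : ℕ) (n : ℕ) (hn : n ≤ lam)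
    (hfa : ∀ m < n, G.Adj (f (m + 1)) (f m)) (p : Fin k → V) (hp : Function.Injective p)
    (i : Fin k) (hi : p i = f n) :
    ∃ c0, Mv G (2 * ((lam + 22 * k ^ 3) * k) + 22 * k ^ 3) p c0 ∧
      c0 i ∈ HH w x A B ∧ (∀ j, p j ∈ HH w x A B → c0 j ∈ HH w x A B) ∧
      (∀ j, j ≠ i → p j ∉ HH w x A B → c0 j = p j) := by
  have hHc : 2 * k ≤ (HH w x A B).card := by
    have h1 : (A ∪ B).card ≤ (HH w x A B).card := Finset.card_le_card (by unfold HH; grind)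
    rw [Finset.card_union_of_disjoint hv.disj] at h1
    omega
  set H := HH w x A B with hH
  obtain ⟨c0, c1, c2, c3⟩ := exists_placement (H := H) (F := ∅)
    (Y := Finset.univ.filter (fun r => p r ∈ H ∨ r = i)) p (fun r r' _ _ h => hp h) hHc (by simp)
  simp only [Finset.mem_filter, Finset.mem_univ, true_and, not_or] at c2 c3
  refine ⟨c0, ?_, (c3 i (Or.inr rfl)).1, fun j hj => (c3 j (Or.inl hj)).1, fun j hj hj' => c2 j ⟨hj', hj⟩⟩
  obtain ⟨q, N, m1, hN, q1, q2, q3, q4⟩ := hv.clearPath hA hB f hf0 lam n hn hfa p hp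
  obtain ⟨q', N', m1', hN', q1', q2', q3', q4'⟩ := hv.clearPath hA hB f hf0 lam n hn hfa c0 c1
  rw [← hH] at *
  have hs : Supp H q q' := by
    intro r
    by_cases hq : q r ∈ H
    · left
      refine ⟨hq, ?_⟩
      by_cases hY : p r ∈ H ∨ r = i
      · exact q1' r (c3 r hY).1
      · have hc := c2 r (by tauto)
        rcases q4 r hq with h | ⟨m, hm, h⟩
        · exact absurd (Or.inl h) hY
        · have hfm : f m ∉ H := fun h' => hY (Or.inl (by rw [h]; exact h'))
          rcases q2' r with h' | h'
          · exact h'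
          · exact absurd (h'.trans (hc.trans h)) (q3' m hm hfm r)
    · right
      have hqp := (q2 r).resolve_left hq
      have hpH : p r ∉ H := by rw [← hqp]; exact hq
      have hpath : ∀ m ≤ n, p r ≠ f m := fun m hm h => 
        q3 m hm (by rw [← h]; exact hpH) r (hqp.trans h)
      have hri : r ≠ i := fun h => hpath n le_rfl (by rw [h, hi])
      have hc := c2 r ⟨hpH, hri⟩
      rcases q2' r with h | h
      · rcases q4' r h with h | ⟨m, hm, h⟩
        · rw [hc] at h; exact absurd h hpH
        · rw [hc] at h; exact absurd h (hpath m hm)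
      · rw [h, hc, hqp]
  have m2 := hv.reconf hA hB (m1.inj hp) (m1'.inj c1) hs
  refine (m1.trans m2).trans' m1'.symm ?_
  have h1 := Nat.mul_le_mul_left (lam + 22 * k ^ 3) (cnt_le_k q H)
  have h2 := Nat.mul_le_mul_left (lam + 22 * k ^ 3) (cnt_le_k q' H)
  omega

theorem Hv.lenBound {w x : V} {A B : Finset V} (hv : Hv G k w x A B) (hA : k ≤ A.card)
    (hB : k ≤ B.card) {I : Inst V G k} (S : Sched I) (hS : Optimal S)
    (f : ℕ → V) (hf0 : f 0 ∈ HH w x A B) (lam : ℕ) (n : ℕ) (hn : n ≤ lam)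
    (hfa : ∀ m < n, G.Adj (f (m + 1)) (f m)) (i : Fin k) (hiM : ¬ I.isM i)
    (hi : I.start i = f n) :
    routeLength S i ≤ 2 * ((lam + 22 * k ^ 3) * k) + 22 * k ^ 3 + 22 * k ^ 3 * (2 * k + 1) := by
  classical
  obtain ⟨c0, m0, h1, h2, h3⟩ := hv.bringIn hA hB f hf0 lam n hn hfa I.start I.start_inj i hi
  obtain ⟨S', hS'⟩ := hv.park hA hB S (fun j => j = i) (fun j h => by rw [h]; exact hiM) _ c0 m0
    (fun j => ⟨fun h => by rw [h]; exact h1, h2 j, h3 j⟩)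
  have hle := (hS S').trans hS'
  have hper : ∀ t, (Finset.univ.filter (fun r => ¬ ((r = i ∨ Pk0 S (HH w x A B) t r) ∧
        (r = i ∨ Pk0 S (HH w x A B) (t + 1) r)) ∧ S.pos t r ≠ S.pos (t + 1) r)).card +
      (if S.pos t i ≠ S.pos (t + 1) i then 1 else 0) ≤ cst (S.pos t) (S.pos (t + 1)) := by
    intro t
    by_cases hm : S.pos t i ≠ S.pos (t + 1) i
    · rw [if_pos hm, cst, Nat.add_one_le_iff]
      refine Finset.card_lt_card ⟨fun r hr => ?_, fun hh => ?_⟩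
      · simp only [Finset.mem_filter, Finset.mem_univ, true_and] at hr ⊢; exact hr.2
      · have := @hh i (by simpa using hm)
        simp at this
    · rw [if_neg hm, cst, add_zero]
      refine Finset.card_le_card fun r hr => ?_
      simp only [Finset.mem_filter, Finset.mem_univ, true_and] at hr ⊢; exact hr.2
  have hsum := Finset.sum_le_sum fun t (_ : t ∈ Finset.range S.T) => hper t
  rw [Finset.sum_add_distrib, ← routeLength_eq, ← totalLength_eq] at hsum
  have hle2 : totalLength S ≤ (2 * ((lam + 22 * k ^ 3) * k) + 22 * k ^ 3) +
      (∑ t ∈ Finset.range S.T, (Finset.univ.filter (fun r => ¬ ((r = i ∨ Pk0 S (HH w x A B) t r) ∧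
        (r = i ∨ Pk0 S (HH w x A B) (t + 1) r)) ∧ S.pos t r ≠ S.pos (t + 1) r)).card)
      + 22 * k ^ 3 * (2 * k + 1) := hle.trans (le_of_eq (by congr!))
  omega

theorem exists_RT (C : G.Subgraph) (hC : C.Connected) (w : V) (hw : w ∈ C.verts) (n : ℕ)
    (hn : n + 1 ≤ C.verts.ncard) :
    ∃ A : Finset V, A.card = n ∧ (A : Set V) ⊆ C.verts ∧ RT G w A n := by
  induction n with
  | zero => exact ⟨∅, rfl, by simp, by simp, fun _ => w, fun _ => 0, by simp⟩
  | succ n ih =>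
    obtain ⟨A, hAc, hAC, hwA, par, d, hd⟩ := ih (by omega)
    have hfin : C.verts.Finite := Set.finite_of_ncard_pos (by omega)
    obtain ⟨b, hbC, hbA⟩ : ∃ b ∈ C.verts, b ∉ insert w A := by
      by_contra hcon
      push Not at hcon
      have : C.verts ⊆ ((insert w A : Finset V) : Set V) := fun b hb => by exact_mod_cast hcon b hb
      have := Set.ncard_le_ncard this (Finset.finite_toSet _)
      rw [Set.ncard_coe_finset] at this
      have := Finset.card_insert_le w A
      omega
    obtain ⟨W⟩ := hC.coe.preconnected ⟨w, hw⟩ ⟨b, hbC⟩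
    obtain ⟨e, -, he1, he2⟩ := W.exists_boundary_dart {v | (v : V) ∈ insert w A} (by simp) hbA
    have hadj : G.Adj (e.fst.1 : V) (e.snd.1 : V) := C.adj_sub e.adj
    set u : V := e.fst.1
    set a : V := e.snd.1
    have hu : u ∈ insert w A := he1
    have ha : a ∉ insert w A := he2
    have haC : a ∈ C.verts := e.snd.2
    have haw : a ≠ w := fun h => ha (by simp [h])
    have haA : a ∉ A := fun h => ha (by simp [h])
    have hua : u ≠ a := fun h => ha (h ▸ hu)
    refine ⟨insert a A, by rw [Finset.card_insert_of_notMem haA, hAc], ?_, ?_, Function.update par a u,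
      fun v => if v = a then (if u = w then 1 else d u + 1) else if v = w then 0 else d v, ?_⟩
    · intro v hv
      simp at hv
      rcases hv with rfl | hv
      · exact haC
      · exact hAC hv
    · simp [hwA]; exact haw.symm
    · intro v hv
      by_cases hva : v = a
      · subst hva
        simp only [Function.update_self, if_true, hua, if_false]
        refine ⟨hadj.symm, by simp at hu ⊢; tauto, ?_⟩
        by_cases huw : u = w
        · simp [huw]
        · have := hd u (by simpa [huw] using hu)
          simp [huw]; omega
      · have hvA : v ∈ A := by simpa [hva] using hv
        obtain ⟨h1, h2, h3, h4⟩ := hd v hvA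
        have hvw : v ≠ w := fun h => hwA (h ▸ hvA)
        have hpa : par v ≠ a := fun h => ha (h ▸ h2)
        rw [Function.update_of_ne hva]
        simp only [hva, hvw, hpa, if_false]
        refine ⟨h1, by simp at h2 ⊢; tauto, ?_, by omega⟩
        split_ifs <;> omega

theorem nice_Hv {w : V} (h : IsNice G k w) :
    ∃ x A B, Hv G k w x A B ∧ A.card = k ∧ B.card = k := by
  obtain ⟨C1, C2, C3, h1, h2, h3, h12, h13, h23, n1, n2, n3⟩ := h
  have hw1 : w ∈ C1.verts := (h12 ▸ Set.mem_singleton w : w ∈ C1.verts ∩ C2.verts).1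
  have hw2 : w ∈ C2.verts := (h12 ▸ Set.mem_singleton w : w ∈ C1.verts ∩ C2.verts).2
  have hw3 : w ∈ C3.verts := (h13 ▸ Set.mem_singleton w : w ∈ C1.verts ∩ C3.verts).2
  obtain ⟨A, hA, hA1, rA⟩ := exists_RT C1 h1 w hw1 k n1
  obtain ⟨B, hB, hB2, rB⟩ := exists_RT C2 h2 w hw2 k n2
  obtain ⟨X, hX, hX3, hwX, par, d, hd⟩ := exists_RT C3 h3 w hw3 1 n3
  obtain ⟨x, rfl⟩ := Finset.card_eq_one.1 hX
  obtain ⟨a1, a2, a3, a4⟩ := hd x (by simp)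
  have hx3 : x ∈ C3.verts := hX3 (by simp)
  have hxw : x ≠ w := fun h => hwX (by simp [h])
  have hpx : par x = w := by
    simp at a2
    rcases a2 with h | h
    · exact h
    · rw [h] at a1; exact absurd rfl a1.ne
  refine ⟨x, A, B, ⟨rA, rB, ?_, ?_, ?_, hxw, hpx ▸ a1.symm⟩, hA, hB⟩
  · rw [Finset.disjoint_left]
    intro a ha hb
    have : a ∈ C1.verts ∩ C2.verts := ⟨hA1 ha, hB2 hb⟩
    rw [h12] at this
    exact rA.1 (Set.mem_singleton_iff.1 this ▸ ha)
  · intro hx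
    have : x ∈ C1.verts ∩ C3.verts := ⟨hA1 hx, hx3⟩
    rw [h13] at this; exact hxw this
  · intro hx
    have : x ∈ C2.verts ∩ C3.verts := ⟨hB2 hx, hx3⟩
    rw [h23] at this; exact hxw this

theorem star_unvisited {v : V} (hk : 1 ≤ k) (N : Finset V) (hN : ∀ a ∈ N, G.Adj v a)
    (hc : N.card = 2 * k + 1 + 22 * k ^ 3 * (2 * k + 1)) {I : Inst V G k} (S : Sched I)
    (hS : Optimal S) (s : ℕ) (hs : s ≤ S.T) (i : Fin k) (hi : S.pos s i = v) :
    ∃ u ∈ N, ∀ t ≤ S.T, ∀ r, S.pos t r ≠ u := by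
  have hvN : v ∉ N := fun h => G.loopless.irrefl v (hN v h)
  obtain ⟨x, hx⟩ : N.Nonempty := by rw [← Finset.card_pos]; omega
  have hce : (N.erase x).card = 2 * k + 22 * k ^ 3 * (2 * k + 1) := by
    rw [Finset.card_erase_of_mem hx]; omega
  obtain ⟨A, hAN, hA⟩ := Finset.exists_subset_card_eq (s := N.erase x) (n := k) (by omega)
  have hBc : (N.erase x \ A).card = k + 22 * k ^ 3 * (2 * k + 1) := by
    rw [Finset.card_sdiff_of_subset hAN]; omega
  have key : ∀ X : Finset V, X ⊆ N → RT G v X k := by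
    intro X hX
    refine ⟨fun h => hvN (hX h), fun _ => v, fun a => if a = v then 0 else 1, fun a ha => ?_⟩
    have hav : a ≠ v := fun h => hvN (hX (h ▸ ha))
    refine ⟨(hN a (hX ha)).symm, by simp, by simp [hav], by simp [hav]; omega⟩
  have hsub : N.erase x ⊆ N := Finset.erase_subset _ _
  have hBN : N.erase x \ A ⊆ N := Finset.sdiff_subset.trans hsub
  have hv : Hv G k v x A (N.erase x \ A) :=
    { rA := key A (hAN.trans hsub)
      rB := key _ hBN
      disj := Finset.disjoint_sdiff
      xA := fun h => by simpa using hAN h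
      xB := fun h => by simp at h
      xw := fun h => hvN (h ▸ hx)
      adj := hN x hx }
  have hHH : HH v x A (N.erase x \ A) = insert v N := by
    unfold HH
    rw [Finset.union_sdiff_of_subset hAN, Finset.insert_erase hx]
  obtain ⟨u, hu, hu2⟩ := hv.unvisited hA.ge (by omega) S hS (by
    rw [hHH, Finset.card_insert_of_notMem hvN, hc]; omega)
  rw [hHH, Finset.mem_insert] at hu
  rcases hu with rfl | hu
  · exact absurd hi (hu2 s hs i)
  · exact ⟨u, hu, hu2⟩

theorem reroute {I : Inst V G k} (S : Sched I) (hS : Optimal S) (i : Fin k) (hiM : ¬ I.isM i)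
    (s : ℕ) (hs : s < S.T) (u : V) (hu : ∀ t ≤ S.T, ∀ r, S.pos t r ≠ u)
    (ha : G.Adj (S.pos s i) u) (hm : S.pos s i ≠ S.pos (s + 1) i) :
    ∃ S' : Sched I, S'.T = S.T ∧ totalLength S' = totalLength S ∧
      (∀ t ≤ s, S'.pos t i = S.pos t i) ∧ (∀ t, s < t → S'.pos t i = u) ∧
      ∀ t r, r ≠ i → S'.pos t r = S.pos t r := by
  let p : ℕ → Fin k → V := fun t r => if r = i ∧ s < t then u else S.pos t r
  have p1 : ∀ t r, r ≠ i → p t r = S.pos t r := fun t r h => by simp [p, h]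
  have p2 : ∀ t r, t ≤ s → p t r = S.pos t r := fun t r h => by simp [p]; omega
  have p3 : ∀ t, s < t → p t i = u := fun t h => by simp [p, h]
  let S' : Sched I :=
    { T := S.T
      pos := p
      init := fun r => by rw [p2 0 r (Nat.zero_le _)]; exact S.init r
      final := fun r hr => by rw [p1 _ r (fun h => hiM (h ▸ hr))]; exact S.final r hr
      step := fun j hj r => by
        by_cases hr : r = i
        · subst hr
          rcases lt_trichotomy j s with h | h | h
          · rw [p2 _ _ (by omega), p2 _ _ (by omega)]; exact S.step j hj r
          · subst h; rw [p2 j _ le_rfl, p3 _ (by omega)]; exact Or.inr ha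
          · rw [p3 _ h, p3 _ (by omega)]; exact Or.inl rfl
        · rw [p1 _ _ hr, p1 _ _ hr]; exact S.step j hj r
      noVertexConflict := fun j hj r r' h => by
        have h : p j r = p j r' := h
        by_cases hjs : j ≤ s
        · rw [p2 _ _ hjs, p2 _ _ hjs] at h; exact S.noVertexConflict j hj h
        · by_cases hr : r = i <;> by_cases hr' : r' = i
          · rw [hr, hr']
          · rw [hr, p3 _ (by omega), p1 _ _ hr'] at h; exact absurd h.symm (hu j hj r')
          · rw [hr', p3 _ (by omega), p1 _ _ hr] at h; exact absurd h (hu j hj r)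
          · rw [p1 _ _ hr', p1 _ _ hr] at h; exact S.noVertexConflict j hj h
      noSwap := fun j hj r r' hne h => by
        by_cases hjs : j + 1 ≤ s
        · rw [p2 _ _ hjs, p2 _ _ hjs, p2 _ _ (by omega), p2 _ _ (by omega)] at h
          exact S.noSwap j hj r r' hne h
        · by_cases hr : r = i
          · have hr' : r' ≠ i := fun h' => hne (hr.trans h'.symm)
            rw [hr, p3 _ (by omega), p1 _ _ hr'] at h
            exact hu j hj.le r' h.1.symm
          · by_cases hr' : r' = i
            · rw [hr', p3 (j + 1) (by omega), p1 j _ hr] at h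
              exact hu j hj.le r h.2.symm
            · rw [p1 _ _ hr, p1 _ _ hr, p1 _ _ hr', p1 _ _ hr'] at h
              exact S.noSwap j hj r r' hne h }
  refine ⟨S', rfl, le_antisymm ?_ (hS S'), fun t ht => p2 t i ht, p3, p1⟩
  unfold totalLength
  refine Finset.sum_le_sum fun r _ => ?_
  rw [routeLength_eq, routeLength_eq]
  refine Finset.sum_le_sum fun t _ => ?_
  change (if p t r ≠ p (t + 1) r then 1 else 0) ≤ _
  by_cases hr : r = i
  · subst hr
    rcases lt_trichotomy t s with h | h | h
    · rw [p2 _ _ (by omega), p2 _ _ (by omega)]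
    · subst h; rw [if_pos hm]; split_ifs <;> simp
    · rw [p3 _ h, p3 _ (by omega)]; simp
  · rw [p1 _ _ hr, p1 _ _ hr]

def Lv (nb : V → Finset V) (s : V) : ℕ → Finset V
  | 0 => {s}
  | n + 1 => Lv nb s n ∪ (Lv nb s n).biUnion nb

theorem Lv_mono (nb : V → Finset V) (s : V) {m n : ℕ} (h : m ≤ n) : Lv nb s m ⊆ Lv nb s n := by
  induction h with
  | refl => exact subset_rfl
  | step h ih => exact ih.trans Finset.subset_union_left

theorem Lv_next (nb : V → Finset V) (s : V) {n : ℕ} {a b : V} (ha : a ∈ Lv nb s n) (hb : b ∈ nb a) :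
    b ∈ Lv nb s (n + 1) :=
  Finset.mem_union_right _ (Finset.mem_biUnion.2 ⟨a, ha, hb⟩)

theorem Lv_card (nb : V → Finset V) (s : V) (M : ℕ) (h : ∀ v, (nb v).card ≤ M) (n : ℕ) :
    (Lv nb s n).card ≤ (M + 1) ^ n := by
  induction n with
  | zero => simp [Lv]
  | succ n ih =>
    have h1 := Finset.card_union_le (Lv nb s n) ((Lv nb s n).biUnion nb)
    have h2 := Finset.card_biUnion_le_card_mul (Lv nb s n) nb M (fun v _ => h v)
    have h3 : (Lv nb s n).card * (M + 1) ≤ (M + 1) ^ n * (M + 1) := Nat.mul_le_mul_right _ ih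
    rw [pow_succ]
    change (Lv nb s n ∪ (Lv nb s n).biUnion nb).card ≤ _
    nlinarith

theorem nb_exists (G : SimpleGraph V) (M : ℕ) (v : V) : ∃ N : Finset V, (∀ a ∈ N, G.Adj v a) ∧
    N.card ≤ M ∧ (N.card = M ∨ ∀ a, G.Adj v a → a ∈ N) := by
  by_cases hf : (G.neighborSet v).Finite
  · by_cases hc : M ≤ hf.toFinset.card
    · obtain ⟨N, h1, h2⟩ := Finset.exists_subset_card_eq hc
      exact ⟨N, fun a ha => by simpa using h1 ha, h2.le, Or.inl h2⟩
    · exact ⟨hf.toFinset, fun a ha => by simpa using ha, by omega, Or.inr fun a ha => by simpa using ha⟩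
  · obtain ⟨N, h1, h2⟩ := Set.Infinite.exists_subset_card_eq hf M
    exact ⟨N, fun a ha => h1 ha, h2.le, Or.inl h2⟩

theorem pos_mem_Lv {I : Inst V G k} (S : Sched I) (i : Fin k) (nb : V → Finset V) (s : ℕ)
    (hs : s ≤ S.T)
    (h : ∀ t < s, S.pos t i ≠ S.pos (t + 1) i → S.pos (t + 1) i ∈ nb (S.pos t i)) :
    S.pos s i ∈ Lv nb (I.start i)
      (∑ t ∈ Finset.range s, if S.pos t i ≠ S.pos (t + 1) i then 1 else 0) := by
  induction s with
  | zero => simp [Lv, S.init i]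
  | succ s ih =>
    have ih := ih (by omega) (fun t ht => h t (by omega))
    rw [Finset.sum_range_succ]
    by_cases hm : S.pos s i = S.pos (s + 1) i
    · rw [if_neg (by simpa using hm), add_zero, ← hm]; exact ih
    · rw [if_pos hm]; exact Lv_next _ _ ih (h s (by omega) hm)

theorem pos_mem_Lv' {I : Inst V G k} (S : Sched I) (i : Fin k) (nb : V → Finset V) (s : ℕ)
    (hs : s ≤ S.T)
    (h : ∀ t < s, S.pos t i ≠ S.pos (t + 1) i → S.pos (t + 1) i ∈ nb (S.pos t i))
    (D : ℕ) (hD : routeLength S i ≤ D) :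
    S.pos s i ∈ Lv nb (I.start i) D := by
  refine Lv_mono _ _ (le_trans ?_ hD) (pos_mem_Lv S i nb s hs h)
  rw [routeLength_eq]
  exact Finset.sum_le_sum_of_subset (by simpa using hs)

theorem arith1 (hk : 2 ≤ k) (lam : ℕ) :
    (2 * k + 1 + 22 * k ^ 3 * (2 * k + 1) + 1) ^
      (2 * ((lam + 22 * k ^ 3) * k) + 22 * k ^ 3 + 22 * k ^ 3 * (2 * k + 1) + 1) ≤
      k ^ (2400 * (lam * k + k ^ 4)) := by
  have h3 : k ^ 3 * 2 ≤ k ^ 4 := by rw [pow_succ k 3]; exact Nat.mul_le_mul_left _ hk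
  have e4 : k ^ 3 * k = k ^ 4 := (pow_succ k 3).symm
  have h4 : k ≤ k ^ 3 := Nat.le_self_pow (by norm_num) k
  have h5 : 2 * k + 1 + 22 * k ^ 3 * (2 * k + 1) + 1 ≤ 256 * k ^ 4 := by nlinarith
  have h6 : 256 * k ^ 4 ≤ k ^ 12 := by
    rw [show k ^ 12 = k ^ 8 * k ^ 4 by ring]
    exact Nat.mul_le_mul_right _ (by simpa using Nat.pow_le_pow_left hk 8)
  have h7 : 2 * ((lam + 22 * k ^ 3) * k) + 22 * k ^ 3 + 22 * k ^ 3 * (2 * k + 1) + 1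
      ≤ 200 * (lam * k + k ^ 4) := by nlinarith [Nat.zero_le (lam * k)]
  calc _ ≤ (k ^ 12) ^ (2 * ((lam + 22 * k ^ 3) * k) + 22 * k ^ 3 + 22 * k ^ 3 * (2 * k + 1) + 1) :=
        Nat.pow_le_pow_left (h5.trans h6) _
    _ ≤ (k ^ 12) ^ (200 * (lam * k + k ^ 4)) := Nat.pow_le_pow_right (by positivity) h7
    _ = _ := by rw [← pow_mul]; congr 1; ring

theorem main_aux (hk : 2 ≤ k) (I : Inst V G k) (i : Fin k) (lam : ℕ) (hiM : ¬ I.isM i)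
    (n : V) (hn : IsNice G k n) (hr : G.Reachable (I.start i) n)
    (hd : G.dist (I.start i) n ≤ lam) :
    ∃ B : Set V, B.ncard ≤ k ^ (2400 * (lam * k + k ^ 4)) ∧
          ∀ S : Sched I, Optimal S →
            ∃ S' : Sched I, S'.T = S.T ∧ totalLength S' = totalLength S ∧
              (∀ j, j ≤ S'.T → S'.pos j i ∈ B) ∧
              (∀ j, j ≤ S.T → ∀ i' : Fin k, i' ≠ i → S'.pos j i' = S.pos j i') := by
  classical
  choose nb nb1 nb2 nb3 using nb_exists G (2 * k + 1 + 22 * k ^ 3 * (2 * k + 1))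
  set D := 2 * ((lam + 22 * k ^ 3) * k) + 22 * k ^ 3 + 22 * k ^ 3 * (2 * k + 1) with hD
  refine ⟨(Lv nb (I.start i) (D + 1) : Finset V), ?_, ?_⟩
  · rw [Set.ncard_coe_finset]
    exact (Lv_card nb _ _ nb2 _).trans (arith1 hk lam)
  intro S hS
  obtain ⟨x, A, B, hv, hA, hB⟩ := nice_Hv hn
  obtain ⟨W, hW⟩ := hr.symm.exists_walk_length_eq_dist
  have hlen : routeLength S i ≤ D := by
    refine hv.lenBound hA.ge hB.ge S hS (fun m => W.getVert m) (by simp [HH]) lam W.length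
      (by rw [hW, SimpleGraph.dist_comm]; exact hd) (fun m hm => (W.adj_getVert_succ hm).symm) i hiM
      (by simp)
  have hmono : Lv nb (I.start i) D ⊆ Lv nb (I.start i) (D + 1) := Lv_mono _ _ (by omega)
  by_cases hex : ∃ s, s < S.T ∧ S.pos s i ≠ S.pos (s + 1) i ∧ S.pos (s + 1) i ∉ nb (S.pos s i)
  · obtain ⟨hs1, hs2, hs3⟩ := Nat.find_spec hex
    have hmin := fun t (ht : t < Nat.find hex) => Nat.find_min hex ht
    set s := Nat.find hex
    have hlow : ∀ t ≤ s, S.pos t i ∈ Lv nb (I.start i) D := fun t ht =>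
      pos_mem_Lv' S i nb t (by omega) (fun t' ht' hm => by
        by_contra hcon
        exact hmin t' (by omega) ⟨by omega, hm, hcon⟩) D hlen
    have hadj : G.Adj (S.pos s i) (S.pos (s + 1) i) :=
      (S.step s hs1 i).resolve_left (fun h => hs2 h.symm)
    have hcard := (nb3 (S.pos s i)).resolve_right (fun h => hs3 (h _ hadj))
    obtain ⟨u, hu, hu2⟩ := star_unvisited (by omega) (nb (S.pos s i)) (nb1 _) hcard S hS s hs1.le i rfl
    obtain ⟨S', q1, q2, q3, q4, q5⟩ := reroute S hS i hiM s hs1 u hu2 (nb1 _ _ hu) hs2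
    refine ⟨S', q1, q2, fun j _ => ?_, fun j _ r hr => q5 j r hr⟩
    by_cases hj : j ≤ s
    · rw [q3 j hj]; exact hmono (hlow j hj)
    · rw [q4 j (by omega)]; exact Lv_next _ _ (hlow s le_rfl) hu
  · push Not at hex
    exact ⟨S, rfl, rfl, fun j hj => hmono (pos_mem_Lv' S i nb j hj
      (fun t ht hm => hex t (by omega) hm) D hlen), fun _ _ _ _ => rfl⟩

theorem main_one (I : Inst V G 1) (i : Fin 1) (hiM : ¬ I.isM i) (S : Sched I) (hS : Optimal S) :
    ∀ j ≤ S.T, S.pos j i = I.start i := by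
  have hu : ∀ r, r = i := fun r => Subsingleton.elim _ _
  obtain ⟨S', hS'⟩ := Mv.toSched (I := I) (Mv.refl (G := G) 0 I.start)
    (fun r hr => absurd (hu r ▸ hr) hiM)
  have h0 : totalLength S = 0 := by have := hS S'; omega
  have h1 : routeLength S i = 0 := by
    unfold totalLength at h0
    exact Finset.sum_eq_zero_iff.1 h0 i (Finset.mem_univ _)
  intro j hj
  have := pos_mem_Lv' S i (fun _ => ∅) j hj (fun t ht hm => by
    rw [routeLength_eq, Finset.sum_eq_zero_iff] at h1
    have := h1 t (by simp; omega)
    rw [if_pos hm] at this; omega) 0 h1.le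
  simpa [Lv] using this

end Aux

/-- **restricting free robots to a small ball.** There is a universal
constant `c > 0` such that: for every GCMP instance with `k` robots and every free robot
`i` whose starting vertex is within distance `lam` of a nice vertex, there is a set
`B ⊆ V(G)` of at most `k ^ (c * (lam * k + k ^ 4))` vertices such that for every optimal
schedule `S` there is a schedule `S'` of the same total traveled length in which robot
`i` occupies only vertices of `B` and every other robot moves exactly as in `S`. -/
theorem free_robot_ball :
    ∃ c : ℕ, 0 < c ∧
      ∀ (V : Type) (G : SimpleGraph V) (k : ℕ) (I : Inst V G k) (i : Fin k) (lam : ℕ),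
        ¬ I.isM i →
        (∃ n : V, IsNice G k n ∧ G.Reachable (I.start i) n ∧ G.dist (I.start i) n ≤ lam) →
        ∃ B : Set V, B.ncard ≤ k ^ (c * (lam * k + k ^ 4)) ∧
          ∀ S : Sched I, Optimal S →
            ∃ S' : Sched I, S'.T = S.T ∧ totalLength S' = totalLength S ∧
              (∀ j, j ≤ S'.T → S'.pos j i ∈ B) ∧
              (∀ j, j ≤ S.T → ∀ i' : Fin k, i' ≠ i → S'.pos j i' = S.pos j i') := by
  classical
  refine ⟨2400, by norm_num, ?_⟩
  intro V G k I i lam hiM ⟨n, hn, hr, hd⟩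
  by_cases hk : 2 ≤ k
  · exact main_aux hk I i lam hiM n hn hr hd
  · obtain rfl : k = 1 := by have := i.2; omega
    refine ⟨{I.start i}, by simp, fun S hS => ⟨S, rfl, rfl, fun j hj => ?_, fun _ _ _ _ => rfl⟩⟩
    exact main_one I i hiM S hS j hj
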